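/- Every matrix representation of the cycle quiver with vertices 1,…,t (with an arbitrary fixed orientation of the arrows) over ℂ is isomorphic to a direct sum of canonical cycle representations of the forms (i), (ii), (iii); moreover this direct sum is determined uniquely up to permutation of summands. -/

import Mathlib

open Matrix

namespace CycleQuiver

/-! The cycle quiver has vertices `0, 1, …, t - 1` (representing `1, …, t`) and arrows
`α_i` joining vertex `i` and vertex `i + 1 (mod t)` for each `i`.  The orientation is
given by `ε : Fin t → Bool`: `ε i = true` means `α_i` is oriented clockwise
(`i → i+1`), and `ε i = false` means counterclockwise (`i+1 → i`). -/

/-- The cyclic successor of a vertex. -/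
def next {t : ℕ} (v : Fin t) : Fin t := ⟨((v : ℕ) + 1) % t, Nat.mod_lt _ v.pos⟩

/-- Source vertex of the arrow `α_i`. -/
def src {t : ℕ} (ε : Fin t → Bool) (i : Fin t) : Fin t := if ε i then i else next i

/-- Target vertex of the arrow `α_i`. -/
def tgt {t : ℕ} (ε : Fin t → Bool) (i : Fin t) : Fin t := if ε i then next i else i

/-- A matrix representation of the cycle quiver: a dimension at each vertex and, for
each arrow, a (target-dim) × (source-dim) complex matrix. -/
structure Rep (t : ℕ) (ε : Fin t → Bool) where
  d : Fin t → ℕ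
  A : ∀ i : Fin t, Matrix (Fin (d (tgt ε i))) (Fin (d (src ε i))) ℂ

variable {t : ℕ} {ε : Fin t → Bool}

/-- Isomorphism of representations: invertible matrices `S v` (with two-sided
inverses `T v`) at each vertex with `Y.A i = S (tgt i) * X.A i * (S (src i))⁻¹`. -/
def Iso (X Y : Rep t ε) : Prop :=
  ∃ (S : ∀ v, Matrix (Fin (Y.d v)) (Fin (X.d v)) ℂ)
    (T : ∀ v, Matrix (Fin (X.d v)) (Fin (Y.d v)) ℂ),
    (∀ v, S v * T v = 1) ∧ (∀ v, T v * S v = 1) ∧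
    ∀ i, Y.A i = S (tgt ε i) * X.A i * T (src ε i)

/-- Arrow-wise block-diagonal direct sum of representations. -/
noncomputable def dsum (X Y : Rep t ε) : Rep t ε where
  d v := X.d v + Y.d v
  A i := Matrix.reindex finSumFinEquiv finSumFinEquiv
    (Matrix.fromBlocks (X.A i) 0 0 (Y.A i))

/-- The zero representation. -/
def zero (t : ℕ) (ε : Fin t → Bool) : Rep t ε := ⟨fun _ => 0, fun _ => 0⟩

/-- Direct sum of a list of representations. -/
noncomputable def dsumList (L : List (Rep t ε)) : Rep t ε := L.foldr dsum (zero t ε)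

/-- A representation is nonzero if some vertex has nonzero dimension. -/
def Nonzero (X : Rep t ε) : Prop := ∃ v, X.d v ≠ 0

/-- Indecomposability: nonzero and not isomorphic to a direct sum of two nonzero
representations. -/
def Indecomposable (X : Rep t ε) : Prop :=
  Nonzero X ∧ ¬ ∃ Y Z : Rep t ε, Nonzero Y ∧ Nonzero Z ∧ Iso X (dsum Y Z)

/-- Regularity: all dimensions are equal and every matrix is (square and) invertible,
invertibility being expressed by a two-sided inverse. -/
def Regular (X : Rep t ε) : Prop :=
  (∀ v w : Fin t, X.d v = X.d w) ∧
  ∀ i : Fin t, ∃ B : Matrix (Fin (X.d (src ε i))) (Fin (X.d (tgt ε i))) ℂ,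
    X.A i * B = 1 ∧ B * X.A i = 1

/-- Singular = not regular. -/
def Singular (X : Rep t ε) : Prop := ¬ Regular X

end CycleQuiver

namespace CycleQuiver

/-- A matrix is an identity-pattern matrix: entry `1` when row index = column index
(as natural numbers), `0` otherwise. -/
def EntryId {a b : ℕ} (M : Matrix (Fin a) (Fin b) ℂ) : Prop :=
  ∀ r s, M r s = if (r : ℕ) = (s : ℕ) then 1 else 0

/-- `M` is the Jordan block `J_n(l)` (including the size conditions). -/
def EntryJ {a b : ℕ} (n : ℕ) (l : ℂ) (M : Matrix (Fin a) (Fin b) ℂ) : Prop :=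
  a = n ∧ b = n ∧
    ∀ r s, M r s = if (s : ℕ) = (r : ℕ) then l else if (s : ℕ) = (r : ℕ) + 1 then 1 else 0

/-- `M` is the `(n-1) × n` matrix `F_n` (`1` iff column = row). -/
def EntryF {a b : ℕ} (n : ℕ) (M : Matrix (Fin a) (Fin b) ℂ) : Prop :=
  a = n - 1 ∧ b = n ∧ ∀ r s, M r s = if (s : ℕ) = (r : ℕ) then 1 else 0

/-- `M` is the `n × (n-1)` matrix `F_nᵀ`. -/
def EntryFT {a b : ℕ} (n : ℕ) (M : Matrix (Fin a) (Fin b) ℂ) : Prop :=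
  a = n ∧ b = n - 1 ∧ ∀ r s, M r s = if (r : ℕ) = (s : ℕ) then 1 else 0

/-- `M` is the `(n-1) × n` matrix `G_n` (`1` iff column = row + 1). -/
def EntryG {a b : ℕ} (n : ℕ) (M : Matrix (Fin a) (Fin b) ℂ) : Prop :=
  a = n - 1 ∧ b = n ∧ ∀ r s, M r s = if (s : ℕ) = (r : ℕ) + 1 then 1 else 0

/-- `M` is the `n × (n-1)` matrix `G_nᵀ`. -/
def EntryGT {a b : ℕ} (n : ℕ) (M : Matrix (Fin a) (Fin b) ℂ) : Prop :=
  a = n ∧ b = n - 1 ∧ ∀ r s, M r s = if (r : ℕ) = (s : ℕ) + 1 then 1 else 0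

variable {t : ℕ} {ε : Fin t → Bool}

/-- Canonical form (i): `(J_n(λ), I_n, …, I_n)` with `λ ≠ 0`
(the Jordan block sits at the first position). -/
def CanonicalI (X : Rep t ε) : Prop :=
  ∃ (i₀ : Fin t) (n : ℕ) (l : ℂ), (i₀ : ℕ) = 0 ∧ 1 ≤ n ∧ l ≠ 0 ∧
    (∀ v, X.d v = n) ∧ (∀ k, k ≠ i₀ → EntryId (X.A k)) ∧ EntryJ n l (X.A i₀)

/-- Canonical form (ii): `J_n(0)` at position `i`, identities `I_n` elsewhere. -/
def CanonicalII (X : Rep t ε) : Prop :=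
  ∃ (i : Fin t) (n : ℕ), 1 ≤ n ∧
    (∀ v, X.d v = n) ∧ (∀ k, k ≠ i → EntryId (X.A k)) ∧ EntryJ n 0 (X.A i)

/-- Membership in the arc `{i+1, …, j}` of the cycle determined by the arrows
`α_i` and `α_j` (for `i < j`); the other arc is its complement. -/
def InArc {t : ℕ} (i j v : Fin t) : Prop := i < v ∧ v ≤ j

/-- Canonical form (iii): distinguished arrows `i < j` carrying the pair `(A_i, A_j)`,
equal to `(F_n, G_n)` or `(F_nᵀ, G_nᵀ)` if `α_i` and `α_j` have opposite directions
around the cycle, and to `(F_n, G_nᵀ)` or `(F_nᵀ, G_n)` if they have the same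
direction; identities at all remaining positions, with dimension `n` on one of the two
arcs into which `α_i` and `α_j` divide the cycle and `n - 1` on the other. -/
def CanonicalIII (X : Rep t ε) : Prop :=
  ∃ (i j : Fin t) (n : ℕ), i < j ∧ 1 ≤ n ∧
    (∀ k, k ≠ i → k ≠ j → EntryId (X.A k)) ∧
    (((∀ v, InArc i j v → X.d v = n) ∧ (∀ v, ¬ InArc i j v → X.d v = n - 1)) ∨
      ((∀ v, InArc i j v → X.d v = n - 1) ∧ (∀ v, ¬ InArc i j v → X.d v = n))) ∧
    ((ε i ≠ ε j ∧
        ((EntryF n (X.A i) ∧ EntryG n (X.A j)) ∨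
         (EntryFT n (X.A i) ∧ EntryGT n (X.A j)))) ∨
     (ε i = ε j ∧
        ((EntryF n (X.A i) ∧ EntryGT n (X.A j)) ∨
         (EntryFT n (X.A i) ∧ EntryG n (X.A j)))))

/-- The canonical representations of the cycle quiver. -/
def Canonical (X : Rep t ε) : Prop := CanonicalI X ∨ CanonicalII X ∨ CanonicalIII X

section Cat
open CategoryTheory CategoryTheory.Limits

/-- Morphisms of representations. -/
@[ext] structure RHom (X Y : Rep t ε) where
  m : ∀ v, Matrix (Fin (Y.d v)) (Fin (X.d v)) ℂ
  comm : ∀ i, m (tgt ε i) * X.A i = Y.A i * m (src ε i)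

instance repCategory : Category (Rep t ε) where
  Hom X Y := RHom X Y
  id X := ⟨fun _ => 1, by simp⟩
  comp f g := ⟨fun v => g.m v * f.m v, fun i => by
    rw [Matrix.mul_assoc, f.comm, ← Matrix.mul_assoc, g.comm, Matrix.mul_assoc]⟩
  id_comp f := by ext1; simp
  comp_id f := by ext1; simp
  assoc f g h := by ext1; simp [Matrix.mul_assoc]

/-- The components of a morphism. -/
def cm {X Y : Rep t ε} (f : X ⟶ Y) : ∀ v, Matrix (Fin (Y.d v)) (Fin (X.d v)) ℂ := RHom.m f

lemma cm_comm {X Y : Rep t ε} (f : X ⟶ Y) (i : Fin t) :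
    cm f (tgt ε i) * X.A i = Y.A i * cm f (src ε i) := RHom.comm f i

lemma hom_ext' {X Y : Rep t ε} {f g : X ⟶ Y} (h : ∀ v, cm f v = cm g v) : f = g :=
  RHom.ext (funext h)

/-- Constructor of morphisms. -/
def mkHom {X Y : Rep t ε} (m : ∀ v, Matrix (Fin (Y.d v)) (Fin (X.d v)) ℂ)
    (h : ∀ i, m (tgt ε i) * X.A i = Y.A i * m (src ε i)) : X ⟶ Y := RHom.mk m h

@[simp] lemma cm_mkHom {X Y : Rep t ε} (m : ∀ v, Matrix (Fin (Y.d v)) (Fin (X.d v)) ℂ)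
    (h : ∀ i, m (tgt ε i) * X.A i = Y.A i * m (src ε i)) : cm (mkHom m h) = m := rfl

@[simp] lemma cm_id (X : Rep t ε) (v : Fin t) : cm (𝟙 X) v = 1 := rfl

@[simp] lemma cm_comp {X Y Z : Rep t ε} (f : X ⟶ Y) (g : Y ⟶ Z) (v : Fin t) :
    cm (f ≫ g) v = cm g v * cm f v := rfl

instance (X Y : Rep t ε) : Zero (X ⟶ Y) := ⟨mkHom (fun _ => 0) (by simp)⟩
instance (X Y : Rep t ε) : Add (X ⟶ Y) :=
  ⟨fun f g => mkHom (fun v => cm f v + cm g v) (fun i => by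
    rw [Matrix.add_mul, Matrix.mul_add, cm_comm, cm_comm])⟩
instance (X Y : Rep t ε) : Neg (X ⟶ Y) :=
  ⟨fun f => mkHom (fun v => - cm f v) (fun i => by
    rw [Matrix.neg_mul, Matrix.mul_neg, cm_comm])⟩
instance (X Y : Rep t ε) : Sub (X ⟶ Y) :=
  ⟨fun f g => mkHom (fun v => cm f v - cm g v) (fun i => by
    rw [Matrix.sub_mul, Matrix.mul_sub, cm_comm, cm_comm])⟩
instance (X Y : Rep t ε) : SMul ℕ (X ⟶ Y) :=
  ⟨fun n f => mkHom (fun v => n • cm f v) (fun i => by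
    rw [Matrix.smul_mul, Matrix.mul_smul, cm_comm])⟩
instance (X Y : Rep t ε) : SMul ℤ (X ⟶ Y) :=
  ⟨fun n f => mkHom (fun v => n • cm f v) (fun i => by
    rw [Matrix.smul_mul, Matrix.mul_smul, cm_comm])⟩

lemma cm_injective (X Y : Rep t ε) : Function.Injective (cm (X := X) (Y := Y)) :=
  fun _ _ h => hom_ext' (fun v => congrFun h v)

instance (X Y : Rep t ε) : AddCommGroup (X ⟶ Y) :=
  (cm_injective X Y).addCommGroup _ rfl (fun _ _ => rfl) (fun _ => rfl) (fun _ _ => rfl)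
    (fun _ _ => rfl) (fun _ _ => rfl)

@[simp] lemma cm_add {X Y : Rep t ε} (f g : X ⟶ Y) (v : Fin t) :
    cm (f + g) v = cm f v + cm g v := rfl
@[simp] lemma cm_zero {X Y : Rep t ε} (v : Fin t) :
    cm (0 : X ⟶ Y) v = 0 := rfl

instance : Preadditive (Rep t ε) where
  add_comp P Q R f f' g := hom_ext' fun v => by simp [Matrix.mul_add]
  comp_add P Q R f g g' := hom_ext' fun v => by simp [Matrix.add_mul]

/-- First projection matrix. -/
def mp1 (a b : ℕ) : Matrix (Fin a) (Fin (a + b)) ℂ :=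
  (Matrix.fromCols 1 0).submatrix id finSumFinEquiv.symm
/-- Second projection matrix. -/
def mp2 (a b : ℕ) : Matrix (Fin b) (Fin (a + b)) ℂ :=
  (Matrix.fromCols 0 1).submatrix id finSumFinEquiv.symm
/-- First injection matrix. -/
def mi1 (a b : ℕ) : Matrix (Fin (a + b)) (Fin a) ℂ :=
  (Matrix.fromRows 1 0).submatrix finSumFinEquiv.symm id
/-- Second injection matrix. -/
def mi2 (a b : ℕ) : Matrix (Fin (a + b)) (Fin b) ℂ :=
  (Matrix.fromRows 0 1).submatrix finSumFinEquiv.symm id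

section mp
variable {a b c d : ℕ} (A : Matrix (Fin a) (Fin c) ℂ) (B : Matrix (Fin b) (Fin d) ℂ)

lemma mp1_mul : mp1 a b * Matrix.reindex finSumFinEquiv finSumFinEquiv
    (Matrix.fromBlocks A 0 0 B) = A * mp1 c d := by
  ext r s
  obtain ⟨s, rfl⟩ := finSumFinEquiv.surjective s
  simp only [Matrix.mul_apply, ← finSumFinEquiv.sum_comp]
  rcases s with s | s <;> simp [mp1, Matrix.one_apply, -finSumFinEquiv_apply_left, -finSumFinEquiv_apply_right]

lemma mp2_mul : mp2 a b * Matrix.reindex finSumFinEquiv finSumFinEquiv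
    (Matrix.fromBlocks A 0 0 B) = B * mp2 c d := by
  ext r s
  obtain ⟨s, rfl⟩ := finSumFinEquiv.surjective s
  simp only [Matrix.mul_apply, ← finSumFinEquiv.sum_comp]
  rcases s with s | s <;> simp [mp2, Matrix.one_apply, -finSumFinEquiv_apply_left, -finSumFinEquiv_apply_right]

lemma mul_mi1 : mi1 a b * A = Matrix.reindex finSumFinEquiv finSumFinEquiv
    (Matrix.fromBlocks A 0 0 B) * mi1 c d := by
  ext r s
  obtain ⟨r, rfl⟩ := finSumFinEquiv.surjective r
  simp only [Matrix.mul_apply, ← finSumFinEquiv.sum_comp]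
  rcases r with r | r <;> simp [mi1, Matrix.one_apply, -finSumFinEquiv_apply_left, -finSumFinEquiv_apply_right]

lemma mul_mi2 : mi2 a b * B = Matrix.reindex finSumFinEquiv finSumFinEquiv
    (Matrix.fromBlocks A 0 0 B) * mi2 c d := by
  ext r s
  obtain ⟨r, rfl⟩ := finSumFinEquiv.surjective r
  simp only [Matrix.mul_apply, ← finSumFinEquiv.sum_comp]
  rcases r with r | r <;> simp [mi2, Matrix.one_apply, -finSumFinEquiv_apply_left, -finSumFinEquiv_apply_right]

lemma mp1_mi1 : mp1 a b * mi1 a b = 1 := by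
  simp [mp1, mi1, Matrix.submatrix_mul_equiv, Matrix.fromCols_mul_fromRows]
lemma mp1_mi2 : mp1 a b * mi2 a b = 0 := by
  simp [mp1, mi2, Matrix.submatrix_mul_equiv, Matrix.fromCols_mul_fromRows]
lemma mp2_mi1 : mp2 a b * mi1 a b = 0 := by
  simp [mp2, mi1, Matrix.submatrix_mul_equiv, Matrix.fromCols_mul_fromRows]
lemma mp2_mi2 : mp2 a b * mi2 a b = 1 := by
  simp [mp2, mi2, Matrix.submatrix_mul_equiv, Matrix.fromCols_mul_fromRows]
lemma mp_total : mi1 a b * mp1 a b + mi2 a b * mp2 a b = 1 := by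
  ext r s
  obtain ⟨r, rfl⟩ := finSumFinEquiv.surjective r
  obtain ⟨s, rfl⟩ := finSumFinEquiv.surjective s
  rcases r with r | r <;> rcases s with s | s <;>
    simp [mp1, mp2, mi1, mi2, Matrix.mul_apply, Matrix.one_apply, -finSumFinEquiv_apply_left, -finSumFinEquiv_apply_right]

end mp

/-- The standard bicone on `dsum X Y`. -/
noncomputable def bicone (X Y : Rep t ε) : BinaryBicone X Y where
  pt := dsum X Y
  fst := mkHom (fun v => mp1 (X.d v) (Y.d v)) (fun _ => mp1_mul _ _)
  snd := mkHom (fun v => mp2 (X.d v) (Y.d v)) (fun _ => mp2_mul _ _)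
  inl := mkHom (fun v => mi1 (X.d v) (Y.d v)) (fun _ => mul_mi1 _ _)
  inr := mkHom (fun v => mi2 (X.d v) (Y.d v)) (fun _ => mul_mi2 _ _)
  inl_fst := hom_ext' fun _ => mp1_mi1
  inl_snd := hom_ext' fun _ => mp2_mi1
  inr_fst := hom_ext' fun _ => mp1_mi2
  inr_snd := hom_ext' fun _ => mp2_mi2

lemma bicone_total (X Y : Rep t ε) :
    (bicone X Y).fst ≫ (bicone X Y).inl + (bicone X Y).snd ≫ (bicone X Y).inr
      = 𝟙 (bicone X Y).pt := hom_ext' fun _ => mp_total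

instance : HasBinaryBiproducts (Rep t ε) where
  has_binary_biproduct X Y := HasBinaryBiproduct.mk
    ⟨bicone X Y, isBinaryBilimitOfTotal _ (bicone_total X Y)⟩

/-- `dsum` is the biproduct. -/
noncomputable def dsumIso (X Y : Rep t ε) : dsum X Y ≅ X ⊞ Y :=
  biprod.uniqueUpToIso X Y (isBinaryBilimitOfTotal (bicone X Y) (bicone_total X Y))

lemma iso_iff {X Y : Rep t ε} : Iso X Y ↔ Nonempty (X ≅ Y) := by
  constructor
  · rintro ⟨S, T, h1, h2, h3⟩
    refine ⟨⟨mkHom S ?_, mkHom T ?_, ?_, ?_⟩⟩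
    · intro i
      rw [h3, Matrix.mul_assoc, Matrix.mul_assoc, h2, Matrix.mul_one]
    · intro i
      rw [h3, ← Matrix.mul_assoc, ← Matrix.mul_assoc, h2, Matrix.one_mul]
    · exact hom_ext' fun v => h2 v
    · exact hom_ext' fun v => h1 v
  · rintro ⟨e⟩
    have h1 : ∀ v, cm e.hom v * cm e.inv v = 1 := fun v => by
      rw [← cm_comp, e.inv_hom_id, cm_id]
    have h2 : ∀ v, cm e.inv v * cm e.hom v = 1 := fun v => by
      rw [← cm_comp, e.hom_inv_id, cm_id]
    refine ⟨cm e.hom, cm e.inv, h1, h2, fun i => ?_⟩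
    rw [cm_comm, Matrix.mul_assoc, h1, Matrix.mul_one]

lemma isZero_zero : IsZero (zero t ε) := by
  rw [IsZero.iff_id_eq_zero]
  exact hom_ext' fun v => by ext r; exact r.elim0

lemma isIso_of_isUnit {X : Rep t ε} (g : X ⟶ X) (h : ∀ v, IsUnit (cm g v)) : IsIso g := by
  have hd : ∀ v, IsUnit (cm g v).det := fun v => (Matrix.isUnit_iff_isUnit_det _).1 (h v)
  refine ⟨mkHom (fun v => (cm g v)⁻¹) (fun i => ?_), ?_, ?_⟩
  · have := cm_comm g i
    calc (cm g (tgt ε i))⁻¹ * X.A i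
        = (cm g (tgt ε i))⁻¹ * (X.A i * cm g (src ε i)) * (cm g (src ε i))⁻¹ := by
          rw [Matrix.mul_assoc, Matrix.mul_assoc, Matrix.mul_nonsing_inv _ (hd _), Matrix.mul_one]
      _ = _ := by
          rw [← this, ← Matrix.mul_assoc, Matrix.nonsing_inv_mul _ (hd _), Matrix.one_mul]
  · exact hom_ext' fun v => Matrix.nonsing_inv_mul _ (hd _)
  · exact hom_ext' fun v => Matrix.mul_nonsing_inv _ (hd _)

end Cat

section KS
open CategoryTheory CategoryTheory.Limits

/-- A form of locality of the endomorphism ring, detected by a diagonal entry. -/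
def LocAt (M : Rep t ε) (v : Fin t) (s : Fin (M.d v)) : Prop :=
  ∀ g : M ⟶ M, cm g v s s ≠ 0 → IsIso g

/-- Local endomorphism ring. -/
def Loc (M : Rep t ε) : Prop := ∃ (v : Fin t) (s : Fin (M.d v)), LocAt M v s

lemma isIso_of_comp {M N : Rep t ε} {v : Fin t} {s : Fin (M.d v)} (hN : Loc N)
    (a : M ⟶ N) (b : N ⟶ M) [IsIso (a ≫ b)] (h0 : cm (a ≫ b) v s s ≠ 0) : IsIso a := by
  obtain ⟨w, r, hN⟩ := hN
  set e : N ⟶ N := b ≫ inv (a ≫ b) ≫ a with he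
  have hae : a ≫ b ≫ inv (a ≫ b) = 𝟙 M := by
    rw [← Category.assoc]; exact IsIso.hom_inv_id _
  have h1 : cm e w r r + cm (𝟙 N - e) w r r = 1 := by
    have : cm (e + (𝟙 N - e)) w r r = 1 := by
      rw [add_sub_cancel]; simp
    rwa [cm_add, Matrix.add_apply] at this
  by_cases hc : cm e w r r = 0
  · have : IsIso (𝟙 N - e) := hN _ (by rw [hc, zero_add] at h1; rw [h1]; exact one_ne_zero)
    have ha : a ≫ (𝟙 N - e) = 0 := by
      rw [Preadditive.comp_sub, he, Category.comp_id, ← Category.assoc b, ← Category.assoc a, hae,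
        Category.id_comp, sub_self]
    have ha0 : a = 0 := by
      rw [← cancel_mono (𝟙 N - e), ha, zero_comp]
    exact absurd (by rw [ha0, zero_comp]; simp) h0
  · have : IsIso e := hN _ hc
    refine ⟨b ≫ inv (a ≫ b), hae, ?_⟩
    have h2 : inv e ≫ b ≫ inv (a ≫ b) ≫ a = 𝟙 N := by
      rw [← he]; simp
    have h3 : inv e ≫ b ≫ inv (a ≫ b) = b ≫ inv (a ≫ b) := by
      calc inv e ≫ b ≫ inv (a ≫ b)
          = inv e ≫ b ≫ inv (a ≫ b) ≫ (a ≫ b ≫ inv (a ≫ b)) := by rw [hae]; simp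
        _ = (inv e ≫ b ≫ inv (a ≫ b) ≫ a) ≫ b ≫ inv (a ≫ b) := by
            simp only [Category.assoc]
        _ = _ := by rw [h2, Category.id_comp]
    rw [← h3]; simpa using h2

/-- Rearrangement of triple biproducts. -/
noncomputable def rot (W N D : Rep t ε) : W ⊞ (N ⊞ D) ≅ N ⊞ (W ⊞ D) where
  hom := biprod.lift (biprod.snd ≫ biprod.fst) (biprod.lift biprod.fst (biprod.snd ≫ biprod.snd))
  inv := biprod.lift (biprod.snd ≫ biprod.fst) (biprod.lift biprod.fst (biprod.snd ≫ biprod.snd))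
  hom_inv_id := by
    apply biprod.hom_ext
    · simp
    · apply biprod.hom_ext <;> simp
  inv_hom_id := by
    apply biprod.hom_ext
    · simp
    · apply biprod.hom_ext <;> simp

/-- Reassociation of triple biproducts. -/
noncomputable def asc (W N D : Rep t ε) : W ⊞ (N ⊞ D) ≅ (W ⊞ N) ⊞ D where
  hom := biprod.lift (biprod.lift biprod.fst (biprod.snd ≫ biprod.fst)) (biprod.snd ≫ biprod.snd)
  inv := biprod.lift (biprod.fst ≫ biprod.fst) (biprod.lift (biprod.fst ≫ biprod.snd) biprod.snd)
  hom_inv_id := by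
    apply biprod.hom_ext
    · simp
    · apply biprod.hom_ext <;> simp
  inv_hom_id := by
    apply biprod.hom_ext
    · apply biprod.hom_ext <;> simp
    · simp

lemma exchange {M : Rep t ε} {v : Fin t} {s : Fin (M.d v)} (hM : LocAt M v s) :
    ∀ (L : List (Rep t ε)), (∀ N ∈ L, Loc N) → ∀ (Y W : Rep t ε) (Φ : M ⊞ Y ≅ W ⊞ dsumList L),
    cm (biprod.inl ≫ Φ.hom ≫ biprod.fst ≫ biprod.inl ≫ Φ.inv ≫ biprod.fst) v s s = 0 →
    ∃ N L'', L.Perm (N :: L'') ∧ Nonempty (M ≅ N) ∧ Nonempty (Y ≅ W ⊞ dsumList L'') := by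
  intro L
  induction L with
  | nil =>
    intro _ Y W Φ h0
    exfalso
    have hz : 𝟙 (dsumList ([] : List (Rep t ε))) = 0 := isZero_zero.eq_of_src _ _
    have h1 : (biprod.fst ≫ biprod.inl : W ⊞ dsumList [] ⟶ W ⊞ dsumList []) = 𝟙 _ := by
      rw [← biprod.total]
      have : (biprod.snd : W ⊞ dsumList [] ⟶ dsumList []) = 0 := by
        rw [← Category.comp_id biprod.snd, hz, comp_zero]
      rw [this]; simp
    have h2 : biprod.inl ≫ Φ.hom ≫ biprod.fst ≫ biprod.inl ≫ Φ.inv ≫ biprod.fst = 𝟙 M := by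
      rw [← Category.assoc biprod.fst, h1]; simp
    rw [h2] at h0
    simp at h0
  | cons N L1 ih =>
    intro hL Y W Φ h0
    let δ : dsumList (N :: L1) ≅ N ⊞ dsumList L1 := dsumIso N (dsumList L1)
    let a : M ⟶ N := biprod.inl ≫ Φ.hom ≫ biprod.snd ≫ δ.hom ≫ biprod.fst
    let b : N ⟶ M := biprod.inl ≫ δ.inv ≫ biprod.inr ≫ Φ.inv ≫ biprod.fst
    by_cases hab : cm (a ≫ b) v s s = 0
    · let Ψ : M ⊞ Y ≅ (W ⊞ N) ⊞ dsumList L1 :=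
        Φ ≪≫ biprod.mapIso (CategoryTheory.Iso.refl W) δ ≪≫ asc W N (dsumList L1)
      have hk : biprod.inl ≫ Ψ.hom ≫ biprod.fst ≫ biprod.inl ≫ Ψ.inv ≫ biprod.fst
          = biprod.inl ≫ Φ.hom ≫ biprod.fst ≫ biprod.inl ≫ Φ.inv ≫ biprod.fst + a ≫ b := by
        have e1 : biprod.inl ≫ Ψ.hom ≫ biprod.fst =
            biprod.lift (biprod.inl ≫ Φ.hom ≫ biprod.fst) a := by
          apply biprod.hom_ext <;> simp [Ψ, asc, a]
        have e2 : biprod.inl ≫ Ψ.inv ≫ biprod.fst =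
            biprod.desc (biprod.inl ≫ Φ.inv ≫ biprod.fst) b := by
          have e3 : biprod.inl ≫ (asc W N (dsumList L1)).inv =
              biprod.desc biprod.inl (biprod.inl ≫ biprod.inr) := by
            apply biprod.hom_ext' <;> apply biprod.hom_ext <;> (try apply biprod.hom_ext) <;>
              simp [asc]
          simp only [Ψ, Iso.trans_inv, Category.assoc]
          rw [← Category.assoc, e3]
          apply biprod.hom_ext' <;> simp [b]
        calc biprod.inl ≫ Ψ.hom ≫ biprod.fst ≫ biprod.inl ≫ Ψ.inv ≫ biprod.fst
            = (biprod.inl ≫ Ψ.hom ≫ biprod.fst) ≫ (biprod.inl ≫ Ψ.inv ≫ biprod.fst) := by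
              simp only [Category.assoc]
          _ = _ := by rw [e1, e2, biprod.lift_desc]; simp only [Category.assoc]
      obtain ⟨N', L2, hp, hi, ⟨hY⟩⟩ := ih (fun N h => hL N (List.mem_cons_of_mem _ h)) Y (W ⊞ N) Ψ (by
        rw [hk, cm_add, Matrix.add_apply, h0, hab, add_zero])
      refine ⟨N', N :: L2, (hp.cons N).trans (List.Perm.swap _ _ _), hi, ⟨?_⟩⟩
      exact hY ≪≫ (asc W N (dsumList L2)).symm ≪≫
        biprod.mapIso (CategoryTheory.Iso.refl W) (dsumIso N (dsumList L2)).symm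
    · have : IsIso (a ≫ b) := hM _ hab
      have ha : IsIso a := isIso_of_comp (hL N (by simp)) a b hab
      let Ψ : M ⊞ Y ≅ N ⊞ (W ⊞ dsumList L1) :=
        Φ ≪≫ biprod.mapIso (CategoryTheory.Iso.refl W) δ ≪≫ rot W N (dsumList L1)
      have h1 : biprod.inl ≫ Ψ.hom ≫ biprod.fst = a := by simp [Ψ, rot, a]
      have : IsIso (biprod.inl ≫ Ψ.hom ≫ biprod.fst) := by rw [h1]; exact ha
      exact ⟨N, L1, List.Perm.refl _, ⟨asIso a⟩, ⟨Biprod.isoElim Ψ⟩⟩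

lemma perm_of_iso (P : Rep t ε → Prop) (hP : ∀ X, P X → Loc X)
    (hiso : ∀ X Y, P X → P Y → Nonempty (X ≅ Y) → X = Y) :
    ∀ L L' : List (Rep t ε), (∀ X ∈ L, P X) → (∀ X ∈ L', P X) →
      Nonempty (dsumList L ≅ dsumList L') → L.Perm L' := by
  intro L
  induction L with
  | nil =>
    rintro L' - hL' ⟨Φ⟩
    cases L' with
    | nil => exact List.Perm.refl _
    | cons N L1 =>
      exfalso
      obtain ⟨v, s, -⟩ := hP N (hL' N (by simp))
      let δ : dsumList (N :: L1) ≅ N ⊞ dsumList L1 := dsumIso N (dsumList L1)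
      have h1 : 𝟙 N = (biprod.inl ≫ δ.inv ≫ Φ.inv) ≫ (Φ.hom ≫ δ.hom ≫ biprod.fst) := by simp
      have h2 : 𝟙 N = 0 := by
        have h4 : biprod.inl ≫ δ.inv ≫ Φ.inv = 0 := isZero_zero.eq_of_tgt _ _
        rw [h1, h4, zero_comp]
      have h3 : cm (𝟙 N) v s s = cm (0 : N ⟶ N) v s s := by rw [h2]
      simp at h3
  | cons M L1 ih =>
    rintro L' hL hL' ⟨Φ⟩
    obtain ⟨v, s, hM⟩ := hP M (hL M (by simp))
    let z : dsumList L' ≅ zero t ε ⊞ dsumList L' := isoZeroBiprod isZero_zero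
    let Ψ : M ⊞ dsumList L1 ≅ zero t ε ⊞ dsumList L' :=
      (dsumIso M (dsumList L1)).symm ≪≫ Φ ≪≫ z
    obtain ⟨N, L2, hp, hi, ⟨hY⟩⟩ := exchange hM L' (fun N h => hP N (hL' N h)) _ _ Ψ (by
      have : (biprod.fst : zero t ε ⊞ dsumList L' ⟶ zero t ε) = 0 := isZero_zero.eq_of_tgt _ _
      rw [this]; simp)
    have hNL : N ∈ L' := hp.mem_iff.2 (by simp)
    have hMN : M = N := hiso _ _ (hL M (by simp)) (hL' N hNL) hi
    subst hMN
    refine List.Perm.trans (List.Perm.cons _ ?_) hp.symm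
    refine ih L2 (fun X h => hL X (List.mem_cons_of_mem _ h))
      (fun X h => hL' X (hp.mem_iff.2 (List.mem_cons_of_mem _ h))) ⟨hY ≪≫ ?_⟩
    exact (isoZeroBiprod isZero_zero).symm

lemma idem_factor {n : ℕ} (e : Matrix (Fin n) (Fin n) ℂ) (he : e * e = e) :
    ∃ (k : ℕ) (ι : Matrix (Fin n) (Fin k) ℂ) (π : Matrix (Fin k) (Fin n) ℂ),
      ι * π = e ∧ π * ι = 1 := by
  let f := Matrix.toLin' e
  let b := Module.finBasis ℂ (LinearMap.range f)
  let c := Pi.basisFun ℂ (Fin n)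
  refine ⟨_, LinearMap.toMatrix b c (LinearMap.range f).subtype,
    LinearMap.toMatrix c b f.rangeRestrict, ?_, ?_⟩
  · rw [← LinearMap.toMatrix_comp c b c]
    have : (LinearMap.range f).subtype ∘ₗ f.rangeRestrict = f := by ext; rfl
    rw [this]
    exact LinearMap.toMatrix'_toLin' e
  · rw [← LinearMap.toMatrix_comp b c b]
    have : f.rangeRestrict ∘ₗ (LinearMap.range f).subtype = LinearMap.id := by
      apply LinearMap.ext
      rintro ⟨x, y, rfl⟩
      apply Subtype.ext
      change f (f y) = f y
      simp only [f, Matrix.toLin'_apply, Matrix.mulVec_mulVec, he]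
    rw [this, LinearMap.toMatrix_id]

lemma split {M X : Rep t ε} {v : Fin t} {s : Fin (M.d v)} (hM : LocAt M v s)
    (psi : M ⟶ X) (phi : X ⟶ M) (h : cm (psi ≫ phi) v s s ≠ 0) :
    ∃ Y : Rep t ε, Nonempty (X ≅ dsum M Y) := by
  have : IsIso (psi ≫ phi) := hM _ h
  let r : X ⟶ M := phi ≫ inv (psi ≫ phi)
  have hr : psi ≫ r = 𝟙 M := by
    simp only [r]; rw [← Category.assoc]; exact IsIso.hom_inv_id _
  have hrv : ∀ w, cm r w * cm psi w = 1 := fun w => by rw [← cm_comp, hr, cm_id]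
  let e : X ⟶ X := 𝟙 X - r ≫ psi
  have he : ∀ w, cm e w = 1 - cm psi w * cm r w := fun w => rfl
  have hee : ∀ w, cm e w * cm e w = cm e w := fun w => by
    have hp : cm psi w * cm r w * (cm psi w * cm r w) = cm psi w * cm r w := by
      rw [Matrix.mul_assoc, ← Matrix.mul_assoc (cm r w), hrv, Matrix.one_mul]
    rw [he]
    generalize cm psi w * cm r w = p at hp
    rw [Matrix.mul_sub, Matrix.sub_mul, Matrix.sub_mul, hp]; simp
  choose k ι π h1 h2 using fun w => idem_factor (cm e w) (hee w)
  have h3 : ∀ w, cm e w * ι w = ι w := fun w => by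
    rw [← h1, Matrix.mul_assoc, h2, Matrix.mul_one]
  have h4 : ∀ w, π w * cm e w = π w := fun w => by
    rw [← h1, ← Matrix.mul_assoc, h2, Matrix.one_mul]
  let Y : Rep t ε := ⟨k, fun i => π (tgt ε i) * X.A i * ι (src ε i)⟩
  let I : Y ⟶ X := mkHom ι (fun i => by
    change ι (tgt ε i) * (π (tgt ε i) * X.A i * ι (src ε i)) = _
    rw [← Matrix.mul_assoc, ← Matrix.mul_assoc, h1, cm_comm, Matrix.mul_assoc, h3])
  let Q : X ⟶ Y := mkHom π (fun i => by
    change _ = (π (tgt ε i) * X.A i * ι (src ε i)) * π (src ε i)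
    rw [Matrix.mul_assoc, h1, Matrix.mul_assoc, ← cm_comm, ← Matrix.mul_assoc, h4])
  have h5 : ∀ w, cm e w * cm psi w = 0 := fun w => by
    rw [he, Matrix.sub_mul, Matrix.mul_assoc, hrv]; simp
  have h6 : ∀ w, cm r w * cm e w = 0 := fun w => by
    rw [he, Matrix.mul_sub, ← Matrix.mul_assoc, hrv]; simp
  let bc : BinaryBicone M Y :=
    { pt := X, fst := r, snd := Q, inl := psi, inr := I
      inl_fst := hr
      inl_snd := hom_ext' fun w => by
        change π w * cm psi w = 0
        rw [← h4, Matrix.mul_assoc, h5, Matrix.mul_zero]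
      inr_fst := hom_ext' fun w => by
        change cm r w * ι w = 0
        rw [← h3, ← Matrix.mul_assoc, h6, Matrix.zero_mul]
      inr_snd := hom_ext' fun w => h2 w }
  have hb : bc.fst ≫ bc.inl + bc.snd ≫ bc.inr = 𝟙 bc.pt := hom_ext' fun w => by
    change cm psi w * cm r w + ι w * π w = 1
    rw [h1, he]; simp
  exact ⟨Y, ⟨biprod.uniqueUpToIso M Y (isBinaryBilimitOfTotal bc hb) ≪≫ (dsumIso M Y).symm⟩⟩

end KS

section Ent

/-- Entries of a matrix extended by zero to all pairs of natural numbers. -/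
noncomputable def ent {a b : ℕ} (M : Matrix (Fin a) (Fin b) ℂ) (r s : ℕ) : ℂ :=
  if h : r < a ∧ s < b then M ⟨r, h.1⟩ ⟨s, h.2⟩ else 0

lemma ent_fin {a b : ℕ} (M : Matrix (Fin a) (Fin b) ℂ) (r : Fin a) (s : Fin b) :
    ent M r s = M r s := by
  simp [ent]

lemma ent_out_row {a b : ℕ} (M : Matrix (Fin a) (Fin b) ℂ) {r s : ℕ} (h : a ≤ r) :
    ent M r s = 0 := by
  rw [ent, dif_neg]; omega

lemma ent_out_col {a b : ℕ} (M : Matrix (Fin a) (Fin b) ℂ) {r s : ℕ} (h : b ≤ s) :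
    ent M r s = 0 := by
  rw [ent, dif_neg]; omega

lemma ent_congr {a b a' b' : ℕ} {M : Matrix (Fin a) (Fin b) ℂ} {M' : Matrix (Fin a') (Fin b') ℂ}
    (ha : a = a') (hb : b = b') (φ : ℕ → ℕ → ℂ) (h : ∀ r s, M r s = φ r s)
    (h' : ∀ r s, M' r s = φ r s) : ent M = ent M' := by
  subst ha hb
  congr 1
  ext r s
  rw [h, h']

lemma rep_ext_ent {X Y : Rep t ε} (hd : ∀ v, X.d v = Y.d v)
    (hA : ∀ i, ent (X.A i) = ent (Y.A i)) : X = Y := by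
  obtain ⟨d, A⟩ := X
  obtain ⟨d', A'⟩ := Y
  obtain rfl : d = d' := funext hd
  congr 1
  funext i
  ext r s
  have := congrFun (congrFun (hA i) r) s
  simpa only [ent_fin] using this

lemma mul_col {a b c : ℕ} (S : Matrix (Fin c) (Fin a) ℂ) (A : Matrix (Fin a) (Fin b) ℂ)
    (s : Fin b) (k : ℕ) (h : ∀ r : Fin a, A r s = if (r : ℕ) = k then 1 else 0) (r : Fin c) :
    (S * A) r s = ent S r k := by
  simp only [Matrix.mul_apply, h]
  by_cases hk : k < a
  · rw [Finset.sum_eq_single ⟨k, hk⟩]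
    · simp [ent, hk]
    · intro x _ hx
      rw [if_neg, mul_zero]
      intro h; exact hx (Fin.ext h)
    · simp
  · rw [ent_out_col _ (by omega)]
    apply Finset.sum_eq_zero
    intro x _
    rw [if_neg (by omega), mul_zero]

lemma mul_row {a b c : ℕ} (B : Matrix (Fin c) (Fin a) ℂ) (S : Matrix (Fin a) (Fin b) ℂ)
    (r : Fin c) (k : ℕ) (h : ∀ s : Fin a, B r s = if (s : ℕ) = k then 1 else 0) (s : Fin b) :
    (B * S) r s = ent S k s := by
  simp only [Matrix.mul_apply, h]
  by_cases hk : k < a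
  · rw [Finset.sum_eq_single ⟨k, hk⟩]
    · simp [ent, hk]
    · intro x _ hx
      rw [if_neg, zero_mul]
      intro h; exact hx (Fin.ext h)
    · simp
  · rw [ent_out_row _ (by omega)]
    apply Finset.sum_eq_zero
    intro x _
    rw [if_neg (by omega), zero_mul]

/-- A triangular Toeplitz pattern with nonzero diagonal is invertible. -/
lemma tri {n N : ℕ} (hn : n ≤ N) (f : ℕ → ℕ → ℂ)
    (hT : ∀ r s, r + 1 < N → s + 1 < N → f (r + 1) (s + 1) = f r s)
    (hz : (∀ r, r + 1 < N → f (r + 1) 0 = 0) ∨ (∀ s, s + 1 < N → f 0 (s + 1) = 0))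
    (h0 : f 0 0 ≠ 0) (M : Matrix (Fin n) (Fin n) ℂ) (hM : ∀ r s, M r s = f r s) :
    IsUnit M := by
  have hs : ∀ k r s, r + k < N → s + k < N → f (r + k) (s + k) = f r s := by
    intro k
    induction k with
    | zero => intros; rfl
    | succ k ih =>
      intro r s h1 h2
      rw [← add_assoc, ← add_assoc, hT _ _ (by omega) (by omega), ih _ _ (by omega) (by omega)]
  have hdiag : ∀ r : Fin n, M r r = f 0 0 := by
    intro r
    rw [hM, ← hs r 0 0 (by omega) (by omega), zero_add]
  rw [Matrix.isUnit_iff_isUnit_det, isUnit_iff_ne_zero]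
  rcases hz with hz | hz
  · rw [Matrix.det_of_isUpperTriangular]
    · rw [Finset.prod_ne_zero_iff]
      intro r _; rw [hdiag]; exact h0
    · intro r s hrs
      have hrs : (s : ℕ) < r := hrs
      obtain ⟨k, hk⟩ : ∃ k, (r : ℕ) = (k + 1) + s := ⟨r - s - 1, by omega⟩
      have := hs s (k + 1) 0 (by omega) (by omega)
      rw [hM, hk]
      rw [zero_add] at this
      rw [this, hz _ (by omega)]
  · rw [Matrix.det_of_isLowerTriangular]
    · rw [Finset.prod_ne_zero_iff]
      intro r _; rw [hdiag]; exact h0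
    · intro r s hrs
      have hrs : (r : ℕ) < s := hrs
      obtain ⟨k, hk⟩ : ∃ k, (s : ℕ) = (k + 1) + r := ⟨s - r - 1, by omega⟩
      have := hs r 0 (k + 1) (by omega) (by omega)
      rw [hM, hk]
      rw [zero_add] at this
      rw [this, hz _ (by omega)]

lemma const_of_next {α : Type*} (H : Fin t → α) (p : Fin t → Prop)
    (hH : ∀ k, p k → H (next k) = H k) (a b : Fin t) (hab : a ≤ b)
    (h : ∀ k, a ≤ k → k < b → p k) : H a = H b := by
  obtain ⟨a, ha⟩ := a
  obtain ⟨b, hb⟩ := b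
  simp only [Fin.mk_le_mk] at hab
  induction b, hab using Nat.le_induction with
  | base => rfl
  | succ b hab ih =>
    rw [ih (by omega) (fun k h1 h2 => h k h1 (lt_trans h2 (by simp)))]
    rw [← hH ⟨b, by omega⟩ (h _ hab (by simp))]
    congr 1
    simp [next, Nat.mod_eq_of_lt hb]

lemma next_of_link {α : Type*} (H : Fin t → α) (k : Fin t) (h : H (tgt ε k) = H (src ε k)) :
    H (next k) = H k := by
  unfold tgt src at h
  split_ifs at h
  · exact h
  · exact h.symm

lemma const_one {α : Type*} (H : Fin t → α) (i : Fin t)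
    (hH : ∀ k, k ≠ i → H (tgt ε k) = H (src ε k)) (v : Fin t) : H v = H i := by
  have hH' := fun k hk => next_of_link H k (hH k hk)
  have ht : 0 < t := i.pos
  have h0 : ∀ v, v ≤ i → H v = H i := fun v hv =>
    const_of_next H _ hH' v i hv (fun k _ h2 => ne_of_lt h2)
  rcases le_or_gt v i with hv | hv
  · exact h0 v hv
  · have hv' : (i : ℕ) < v := hv
    let l : Fin t := ⟨t - 1, by omega⟩
    have h1 : H v = H l := const_of_next H _ hH' v l (by change (v : ℕ) ≤ t - 1; omega)
      (fun k h1 _ => ne_of_gt (lt_of_lt_of_le hv h1))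
    have hl : next l = ⟨0, ht⟩ := by
      apply Fin.ext
      have : t - 1 + 1 = t := by omega
      simp [next, l, this]
    rw [h1, ← hH' l (by intro h; have := congrArg Fin.val h; simp [l] at this; omega), hl]
    exact h0 _ (Nat.zero_le _)

lemma const_two {α : Type*} (H : Fin t → α) (i j : Fin t) (hij : i < j)
    (hH : ∀ k, k ≠ i → k ≠ j → H (tgt ε k) = H (src ε k)) (v : Fin t) :
    (InArc i j v → H v = H j) ∧ (¬ InArc i j v → H v = H i) := by
  have hH' : ∀ k, (k ≠ i ∧ k ≠ j) → H (next k) = H k :=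
    fun k hk => next_of_link H k (hH k hk.1 hk.2)
  have ht : 0 < t := i.pos
  have hij' : (i : ℕ) < j := hij
  constructor
  · rintro ⟨h1, h2⟩
    exact const_of_next H _ hH' v j h2
      (fun k h3 h4 => ⟨ne_of_gt (lt_of_lt_of_le h1 h3), ne_of_lt h4⟩)
  · intro hv
    have h0 : ∀ v, v ≤ i → H v = H i := fun v hv =>
      const_of_next H _ hH' v i hv (fun k _ h2 => ⟨ne_of_lt h2, ne_of_lt (lt_trans h2 hij)⟩)
    rcases le_or_gt v i with hvi | hvi
    · exact h0 v hvi
    · have hvj : j < v := by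
        by_contra h
        exact hv ⟨hvi, not_lt.1 h⟩
      have hv' : (j : ℕ) < v := hvj
      let l : Fin t := ⟨t - 1, by omega⟩
      have h1 : H v = H l := const_of_next H _ hH' v l (by change (v : ℕ) ≤ t - 1; omega)
        (fun k h1 _ => ⟨ne_of_gt (lt_of_lt_of_le hvi h1), ne_of_gt (lt_of_lt_of_le hvj h1)⟩)
      have hl : next l = ⟨0, ht⟩ := by
        apply Fin.ext
        have : t - 1 + 1 = t := by omega
        simp [next, l, this]
      rw [h1, ← hH' l ⟨?_, ?_⟩, hl]
      · exact h0 _ (Nat.zero_le _)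
      · intro h; have := congrArg Fin.val h; simp [l] at this; omega
      · intro h; have := congrArg Fin.val h; simp [l] at this; omega

lemma link_id {a b c e : ℕ} {A : Matrix (Fin a) (Fin b) ℂ} {B : Matrix (Fin c) (Fin e) ℂ}
    {S : Matrix (Fin c) (Fin a) ℂ} {S' : Matrix (Fin e) (Fin b) ℂ} (hA : EntryId A)
    (hB : EntryId B) (h : S * A = B * S') (r s : ℕ) (hr : r < c) (hs : s < b) :
    ent S r s = ent S' r s := by
  have h1 := mul_col S A ⟨s, hs⟩ s (fun r => hA r _) ⟨r, hr⟩
  have h2 := mul_row B S' ⟨r, hr⟩ r (fun s => by rw [hB]; simp [eq_comm]) ⟨s, hs⟩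
  rw [h] at h1
  exact h1.symm.trans h2

lemma link_id_eq {a b c e : ℕ} {A : Matrix (Fin a) (Fin b) ℂ} {B : Matrix (Fin c) (Fin e) ℂ}
    {S : Matrix (Fin c) (Fin a) ℂ} {S' : Matrix (Fin e) (Fin b) ℂ} (hA : EntryId A)
    (hB : EntryId B) (h : S * A = B * S') (hab : a = b) (hce : c = e) :
    ent S = ent S' := by
  funext r s
  by_cases hr : r < c
  · by_cases hs : s < b
    · exact link_id hA hB h r s hr hs
    · rw [ent_out_col _ (by omega), ent_out_col _ (by omega)]
  · rw [ent_out_row _ (by omega), ent_out_row _ (by omega)]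

lemma link_J {n m : ℕ} {a b c e : ℕ} {l l' : ℂ} {A : Matrix (Fin a) (Fin b) ℂ}
    {B : Matrix (Fin c) (Fin e) ℂ}
    {S : Matrix (Fin c) (Fin a) ℂ} {S' : Matrix (Fin e) (Fin b) ℂ} (hA : EntryJ n l A)
    (hB : EntryJ m l' B) (h : S * A = B * S') (r s : ℕ) (hr : r < m) (hs : s < n) :
    l * ent S r s + (if s = 0 then 0 else ent S r (s - 1)) =
      l' * ent S' r s + ent S' (r + 1) s := by
  obtain ⟨rfl, rfl, hA⟩ := hA
  obtain ⟨rfl, rfl, hB⟩ := hB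
  let N1 : Matrix (Fin b) (Fin b) ℂ := fun r s => if (s : ℕ) = r + 1 then 1 else 0
  let N2 : Matrix (Fin e) (Fin e) ℂ := fun r s => if (s : ℕ) = r + 1 then 1 else 0
  have eA : A = l • (1 : Matrix (Fin b) (Fin b) ℂ) + N1 := by
    ext r s
    rw [hA, Matrix.add_apply, Matrix.smul_apply, Matrix.one_apply]
    by_cases h1 : (s : ℕ) = r
    · have : r = s := Fin.ext h1.symm
      simp [h1, this, N1]
    · have : r ≠ s := fun h => h1 (by rw [h])
      simp [h1, this, N1]
  have eB : B = l' • (1 : Matrix (Fin e) (Fin e) ℂ) + N2 := by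
    ext r s
    rw [hB, Matrix.add_apply, Matrix.smul_apply, Matrix.one_apply]
    by_cases h1 : (s : ℕ) = r
    · have : r = s := Fin.ext h1.symm
      simp [h1, this, N2]
    · have : r ≠ s := fun h => h1 (by rw [h])
      simp [h1, this, N2]
  have h3 := congrFun (congrFun h ⟨r, hr⟩) ⟨s, hs⟩
  rw [eA, eB, Matrix.mul_add, Matrix.add_mul, Matrix.mul_smul, Matrix.smul_mul, Matrix.mul_one,
    Matrix.one_mul, Matrix.add_apply, Matrix.add_apply, Matrix.smul_apply, Matrix.smul_apply,
    smul_eq_mul, smul_eq_mul, ← ent_fin S, ← ent_fin S'] at h3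
  rw [mul_row N2 S' ⟨r, hr⟩ (r + 1) (fun s => rfl)] at h3
  by_cases hs0 : s = 0
  · rw [mul_col S N1 ⟨s, hs⟩ b (fun r => by
      simp only [N1]; rw [if_neg (by simp [hs0]), if_neg (by omega)]), ent_out_col _ (le_refl _)] at h3
    rw [if_pos hs0]; exact h3
  · rw [mul_col S N1 ⟨s, hs⟩ (s - 1) (fun r => by
      simp only [N1]; congr 1; simp only [eq_iff_iff]; omega)] at h3
    rw [if_neg hs0]; exact h3

end Ent

section Canon
open CategoryTheory

lemma isUnit_vertex {X : Rep t ε} {v : Fin t} {n N : ℕ} (hv : X.d v = n) (hn : n ≤ N)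
    (M : Matrix (Fin (X.d v)) (Fin (X.d v)) ℂ) (f : ℕ → ℕ → ℂ)
    (hT : ∀ r s, r + 1 < N → s + 1 < N → f (r + 1) (s + 1) = f r s)
    (hz : (∀ r, r + 1 < N → f (r + 1) 0 = 0) ∨ (∀ s, s + 1 < N → f 0 (s + 1) = 0))
    (h0 : f 0 0 ≠ 0) (hM : ∀ r s, r < n → s < n → ent M r s = f r s) : IsUnit M := by
  refine tri (N := N) (by omega) f hT hz h0 M (fun r s => ?_)
  rw [← ent_fin M]
  exact hM r s (by omega) (by omega)

lemma locJ {X : Rep t ε} {i : Fin t} {n : ℕ} {l : ℂ} (hd : ∀ v, X.d v = n)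
    (hk : ∀ k, k ≠ i → EntryId (X.A k)) (hJ : EntryJ n l (X.A i)) (v : Fin t)
    (s : Fin (X.d v)) (hs : (s : ℕ) = 0) : LocAt X v s := by
  intro g hg
  have hH : ∀ v, ent (cm g v) = ent (cm g i) :=
    const_one (ε := ε) (fun v => ent (cm g v)) i (fun k hki =>
      link_id_eq (hk k hki) (hk k hki) (cm_comm g k) (by rw [hd, hd]) (by rw [hd, hd]))
  set f := ent (cm g i) with hf
  have hlink := link_J hJ hJ (cm_comm g i)
  rw [hH (tgt ε i), hH (src ε i)] at hlink
  have hf0 : f 0 0 ≠ 0 := by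
    rw [← hH v]
    rw [← ent_fin (cm g v), hs] at hg
    exact hg
  apply isIso_of_isUnit
  intro w
  refine isUnit_vertex (N := n) (hd w) le_rfl _ f ?_ (Or.inl ?_) hf0 (fun r s _ _ => by rw [hH w])
  · intro r s hr hs
    have := hlink r (s + 1) (by omega) (by omega)
    simp at this
    exact this.symm
  · intro r hr
    have := hlink r 0 (by omega) (by omega)
    simpa using this

/-- Uniform description of the representations of type (iii). -/
def Data3 (X : Rep t ε) (i j : Fin t) (n : ℕ) : Prop :=
  i < j ∧ 1 ≤ n ∧ (∀ k, k ≠ j → EntryId (X.A k)) ∧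
    (((∀ v, InArc i j v → X.d v = n) ∧ (∀ v, ¬ InArc i j v → X.d v = n - 1)) ∨
      ((∀ v, InArc i j v → X.d v = n - 1) ∧ (∀ v, ¬ InArc i j v → X.d v = n))) ∧
    ((X.d (tgt ε i) = n ∧ X.d (src ε i) = n - 1) ∨
      (X.d (tgt ε i) = n - 1 ∧ X.d (src ε i) = n)) ∧
    (EntryG n (X.A j) ∨ EntryGT n (X.A j))

lemma data3_of_canonicalIII {X : Rep t ε} (h : CanonicalIII X) : ∃ i j n, Data3 X i j n := by
  obtain ⟨i, j, n, hij, hn, hk, hd, h⟩ := h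
  refine ⟨i, j, n, hij, hn, ?_, hd, ?_, ?_⟩
  · intro k hkj
    by_cases hki : k = i
    · subst hki
      rcases h with ⟨-, ⟨h, -⟩ | ⟨h, -⟩⟩ | ⟨-, ⟨h, -⟩ | ⟨h, -⟩⟩
      · intro r s; rw [h.2.2]; simp [eq_comm]
      · exact h.2.2
      · intro r s; rw [h.2.2]; simp [eq_comm]
      · exact h.2.2
    · exact hk k hki hkj
  · rcases h with ⟨-, ⟨h, -⟩ | ⟨h, -⟩⟩ | ⟨-, ⟨h, -⟩ | ⟨h, -⟩⟩
    · exact Or.inr ⟨h.1, h.2.1⟩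
    · exact Or.inl ⟨h.1, h.2.1⟩
    · exact Or.inr ⟨h.1, h.2.1⟩
    · exact Or.inl ⟨h.1, h.2.1⟩
  · rcases h with ⟨-, ⟨-, h⟩ | ⟨-, h⟩⟩ | ⟨-, ⟨-, h⟩ | ⟨-, h⟩⟩
    · exact Or.inl h
    · exact Or.inr h
    · exact Or.inr h
    · exact Or.inl h

lemma loc3 {X : Rep t ε} {i j : Fin t} {n : ℕ} (h : Data3 X i j n) (v : Fin t)
    (s : Fin (X.d v)) (hv : X.d v = n) (hs : (s : ℕ) = 0) : LocAt X v s := by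
  obtain ⟨hij, hn, hk, hd, hi, hj⟩ := h
  intro g hg
  have hd2 : ∀ v, X.d v = n ∨ X.d v = n - 1 := by
    intro v
    rcases hd with ⟨h1, h2⟩ | ⟨h1, h2⟩
    · by_cases hv : InArc i j v
      · exact Or.inl (h1 v hv)
      · exact Or.inr (h2 v hv)
    · by_cases hv : InArc i j v
      · exact Or.inr (h1 v hv)
      · exact Or.inl (h2 v hv)
  have hside : ∀ k, k ≠ i → k ≠ j → X.d (tgt ε k) = X.d (src ε k) := by
    intro k hki hkj
    have hki' : (k : ℕ) ≠ i := fun h => hki (Fin.ext h)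
    have hkj' : (k : ℕ) ≠ j := fun h => hkj (Fin.ext h)
    have hij' : (i : ℕ) < j := hij
    have : InArc i j (next k) ↔ InArc i j k := by
      have hkt := k.2
      have hjt := j.2
      unfold InArc next
      simp only [Fin.lt_def, Fin.le_def]
      rcases Nat.lt_or_ge (k + 1) t with h | h
      · rw [Nat.mod_eq_of_lt h]; omega
      · have : (k : ℕ) + 1 = t := by omega
        rw [this, Nat.mod_self]; omega
    have h2 : X.d (next k) = X.d k := by
      by_cases hv : InArc i j k
      · rcases hd with ⟨h1, h2⟩ | ⟨h1, h2⟩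
        · rw [h1 _ hv, h1 _ (this.2 hv)]
        · rw [h1 _ hv, h1 _ (this.2 hv)]
      · have hv' : ¬ InArc i j (next k) := fun h => hv (this.1 h)
        rcases hd with ⟨h1, h2⟩ | ⟨h1, h2⟩
        · rw [h2 _ hv, h2 _ hv']
        · rw [h2 _ hv, h2 _ hv']
    unfold tgt src
    split_ifs
    · exact h2
    · exact h2.symm
  have hH := const_two (ε := ε) (fun v => ent (cm g v)) i j hij (fun k hki hkj =>
      link_id_eq (hk k hkj) (hk k hkj) (cm_comm g k) (hside k hki hkj) (hside k hki hkj))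
  obtain ⟨P, Q, hP, hQ⟩ : ∃ P Q, (∀ v, X.d v = n → ent (cm g v) = P) ∧
      (∀ v, X.d v = n - 1 → ent (cm g v) = Q) := by
    rcases hd with ⟨h1, h2⟩ | ⟨h1, h2⟩
    · refine ⟨_, _, fun v hv => (hH v).1 ?_, fun v hv => (hH v).2 ?_⟩
      · by_contra h; have := h2 v h; omega
      · intro h; have := h1 v h; omega
    · refine ⟨_, _, fun v hv => (hH v).2 ?_, fun v hv => (hH v).1 ?_⟩
      · intro h; have := h1 v h; omega
      · by_contra h; have := h2 v h; omega
  have hPQ : ∀ r s, r < n - 1 → s < n - 1 → Q r s = P r s := by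
    intro r s hr hs
    have := link_id (hk i (ne_of_lt hij)) (hk i (ne_of_lt hij)) (cm_comm g i) r s
    rcases hi with ⟨h1, h2⟩ | ⟨h1, h2⟩
    · rw [hP _ h1, hQ _ h2] at this
      exact (this (by omega) (by omega)).symm
    · rw [hP _ h2, hQ _ h1] at this
      exact this (by omega) (by omega)
  have hf0 : P 0 0 ≠ 0 := by
    rw [← hP v hv]
    rw [← ent_fin (cm g v), hs] at hg
    exact hg
  suffices hh : (∀ r s, r + 1 < n → s + 1 < n → P (r + 1) (s + 1) = P r s) ∧
      ((∀ r, r + 1 < n → P (r + 1) 0 = 0) ∨ (∀ s, s + 1 < n → P 0 (s + 1) = 0)) by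
    apply isIso_of_isUnit
    intro w
    rcases hd2 w with hw | hw
    · exact isUnit_vertex (N := n) hw le_rfl _ P hh.1 hh.2 hf0 (fun r s _ _ => by rw [hP w hw])
    · exact isUnit_vertex (N := n) hw (by omega) _ P hh.1 hh.2 hf0
        (fun r s hr hs => by rw [hQ w hw, hPQ r s hr hs])
  rcases hj with ⟨h1, h2, h3⟩ | ⟨h1, h2, h3⟩
  · have key : ∀ r s, r + 1 < n → s < n → (if s = 0 then 0 else Q r (s - 1)) = P (r + 1) s := by
      intro r s hr hs
      have e := congrFun (congrFun (cm_comm g j) ⟨r, by omega⟩) ⟨s, by omega⟩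
      rw [mul_row (X.A j) (cm g (src ε j)) _ (r + 1) (fun s => h3 _ s), hP _ h2] at e
      rw [← e]
      by_cases h0 : s = 0
      · rw [if_pos h0, mul_col _ _ _ n (fun r => by
          rw [h3, if_neg (by simp [h0]), if_neg (by omega)]), ent_out_col _ (by omega)]
      · rw [if_neg h0, mul_col _ _ _ (s - 1) (fun r => by
          rw [h3]; congr 1; simp only [eq_iff_iff]; omega), hQ _ h1]
    refine ⟨fun r s hr hs => ?_, Or.inl fun r hr => ?_⟩
    · have := key r (s + 1) hr (by omega)
      simp at this
      rw [← this, hPQ _ _ (by omega) (by omega)]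
    · simpa using (key r 0 hr (by omega)).symm
  · have key : ∀ r s, r < n → s + 1 < n → P r (s + 1) = (if r = 0 then 0 else Q (r - 1) s) := by
      intro r s hr hs
      have e := congrFun (congrFun (cm_comm g j) ⟨r, by omega⟩) ⟨s, by omega⟩
      rw [mul_col (cm g (tgt ε j)) (X.A j) _ (s + 1) (fun r => h3 r _), hP _ h1] at e
      rw [e]
      by_cases h0 : r = 0
      · rw [if_pos h0, mul_row _ _ _ n (fun r => by
          rw [h3, if_neg (by simp [h0]), if_neg (by omega)]), ent_out_row _ (by omega)]
      · rw [if_neg h0, mul_row _ _ _ (r - 1) (fun s => by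
          rw [h3]; congr 1; simp only [eq_iff_iff]; omega), hQ _ h2]
    refine ⟨fun r s hr hs => ?_, Or.inr fun s hs => ?_⟩
    · have := key (r + 1) s (by omega) hs
      simp at this
      rw [this, hPQ _ _ (by omega) (by omega)]
    · simpa using (key 0 s (by omega) hs)

lemma data3_dim {X : Rep t ε} {i j : Fin t} {n : ℕ} (h : Data3 X i j n) : ∃ v, X.d v = n := by
  obtain ⟨hij, hn, hk, hd, hi, hj⟩ := h
  rcases hi with h | h
  · exact ⟨_, h.1⟩
  · exact ⟨_, h.2⟩

lemma loc_of_canonical (X : Rep t ε) (h : Canonical X) : Loc X := by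
  rcases h with ⟨i, n, l, _, hn, _, hd, hk, hJ⟩ | ⟨i, n, hn, hd, hk, hJ⟩ | h
  · exact ⟨i, ⟨0, by rw [hd]; omega⟩, locJ hd hk hJ _ _ rfl⟩
  · exact ⟨i, ⟨0, by rw [hd]; omega⟩, locJ hd hk hJ _ _ rfl⟩
  · obtain ⟨i, j, n, h⟩ := data3_of_canonicalIII h
    obtain ⟨v, hv⟩ := data3_dim h
    exact ⟨v, ⟨0, by rw [hv]; exact h.2.1⟩, loc3 h v _ hv rfl⟩

/-- Bijectivity of a matrix, as a two-sided inverse. -/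
def Bij {a b : ℕ} (M : Matrix (Fin a) (Fin b) ℂ) : Prop :=
  ∃ B : Matrix (Fin b) (Fin a) ℂ, M * B = 1 ∧ B * M = 1

lemma Bij.dim {a b : ℕ} {M : Matrix (Fin a) (Fin b) ℂ} (h : Bij M) : a = b := by
  obtain ⟨B, h1, h2⟩ := h
  simpa using Matrix.square_of_invertible M B h1 h2

lemma bij_of_isUnit {a : ℕ} {M : Matrix (Fin a) (Fin a) ℂ} (h : IsUnit M) : Bij M := by
  obtain ⟨u, rfl⟩ := h
  exact ⟨(u⁻¹ : _), by simp, by simp⟩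

lemma bij_id {a b : ℕ} {M : Matrix (Fin a) (Fin b) ℂ} (h : EntryId M) (hab : a = b) : Bij M := by
  subst hab
  have : M = 1 := by
    ext r s
    rw [h, Matrix.one_apply]
    simp [Fin.ext_iff]
  subst this
  exact ⟨1, by simp, by simp⟩

lemma bij_J {a b n : ℕ} {l : ℂ} {M : Matrix (Fin a) (Fin b) ℂ} (h : EntryJ n l M) (hl : l ≠ 0) :
    Bij M := by
  obtain ⟨rfl, rfl, h⟩ := h
  apply bij_of_isUnit
  refine tri (N := b) le_rfl
    (fun r s => if s = r then l else if s = r + 1 then 1 else 0) ?_ (Or.inl ?_) (by simpa) M h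
  · intro r s _ _
    simp
  · intro r _
    simp

lemma not_bij_J {a b n : ℕ} {M : Matrix (Fin a) (Fin b) ℂ} (h : EntryJ n 0 M) (hn : 1 ≤ n) :
    ¬ Bij M := by
  obtain ⟨rfl, rfl, h⟩ := h
  rintro ⟨B, -, h2⟩
  have := congrFun (congrFun h2 ⟨0, hn⟩) ⟨0, hn⟩
  rw [Matrix.mul_apply, Finset.sum_eq_zero] at this
  · simp at this
  · intro x _
    rw [h]
    simp

lemma dim_of_iso {X Y : Rep t ε} (h : Nonempty (X ≅ Y)) (v : Fin t) : X.d v = Y.d v := by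
  obtain ⟨S, T, h1, h2, -⟩ := iso_iff.2 h
  have : Bij (T v) := ⟨S v, h2 v, h1 v⟩
  exact this.dim

lemma bij_of_iso {X Y : Rep t ε} (h : Nonempty (X ≅ Y)) (k : Fin t) (hX : Bij (X.A k)) :
    Bij (Y.A k) := by
  obtain ⟨S, T, h1, h2, h3⟩ := iso_iff.2 h
  obtain ⟨B, b1, b2⟩ := hX
  rw [h3]
  refine ⟨S (src ε k) * B * T (tgt ε k), ?_, ?_⟩
  · calc S (tgt ε k) * X.A k * T (src ε k) * (S (src ε k) * B * T (tgt ε k))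
        = S (tgt ε k) * (X.A k * (T (src ε k) * S (src ε k)) * B) * T (tgt ε k) := by
          simp only [Matrix.mul_assoc]
      _ = 1 := by rw [h2, Matrix.mul_one, b1, Matrix.mul_one, h1]
  · calc (S (src ε k) * B * T (tgt ε k)) * (S (tgt ε k) * X.A k * T (src ε k))
        = S (src ε k) * (B * (T (tgt ε k) * S (tgt ε k)) * X.A k) * T (src ε k) := by
          simp only [Matrix.mul_assoc]
      _ = 1 := by rw [h2, Matrix.mul_one, b2, Matrix.mul_one, h1]

lemma bij_iff_of_iso {X Y : Rep t ε} (h : Nonempty (X ≅ Y)) (k : Fin t) :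
    Bij (X.A k) ↔ Bij (Y.A k) :=
  ⟨bij_of_iso h k, bij_of_iso (h.map fun e => e.symm) k⟩

lemma ent_id_eq {a b a' b' : ℕ} {M : Matrix (Fin a) (Fin b) ℂ} {M' : Matrix (Fin a') (Fin b') ℂ}
    (ha : a = a') (hb : b = b') (h : EntryId M) (h' : EntryId M') : ent M = ent M' :=
  ent_congr ha hb (fun r s => if r = s then 1 else 0) h h'

lemma ent_J_eq {a b a' b' n n' : ℕ} {l : ℂ} {M : Matrix (Fin a) (Fin b) ℂ}
    {M' : Matrix (Fin a') (Fin b') ℂ}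
    (ha : a = a') (hb : b = b') (h : EntryJ n l M) (h' : EntryJ n' l M') : ent M = ent M' :=
  ent_congr ha hb (fun r s => if s = r then l else if s = r + 1 then 1 else 0) h.2.2 h'.2.2

lemma data3_bij {X : Rep t ε} {i j : Fin t} {n : ℕ} (h : Data3 X i j n) (k : Fin t) :
    ¬ Bij (X.A k) ↔ k = i ∨ k = j := by
  obtain ⟨hij, hn, hk, hd, hi, hj⟩ := h
  constructor
  · intro hb
    by_contra hc
    push Not at hc
    obtain ⟨hki, hkj⟩ := hc
    refine hb (bij_id (hk k hkj) ?_)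
    have hki' : (k : ℕ) ≠ i := fun h => hki (Fin.ext h)
    have hkj' : (k : ℕ) ≠ j := fun h => hkj (Fin.ext h)
    have hij' : (i : ℕ) < j := hij
    have : InArc i j (next k) ↔ InArc i j k := by
      have hkt := k.2
      have hjt := j.2
      unfold InArc next
      simp only [Fin.lt_def, Fin.le_def]
      rcases Nat.lt_or_ge (k + 1) t with h | h
      · rw [Nat.mod_eq_of_lt h]; omega
      · have : (k : ℕ) + 1 = t := by omega
        rw [this, Nat.mod_self]; omega
    have h2 : X.d (next k) = X.d k := by
      by_cases hv : InArc i j k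
      · rcases hd with ⟨h1, h2⟩ | ⟨h1, h2⟩
        · rw [h1 _ hv, h1 _ (this.2 hv)]
        · rw [h1 _ hv, h1 _ (this.2 hv)]
      · have hv' : ¬ InArc i j (next k) := fun h => hv (this.1 h)
        rcases hd with ⟨h1, h2⟩ | ⟨h1, h2⟩
        · rw [h2 _ hv, h2 _ hv']
        · rw [h2 _ hv, h2 _ hv']
    unfold tgt src
    split_ifs
    · exact h2
    · exact h2.symm
  · rintro (rfl | rfl) hb
    · have := hb.dim; omega
    · have := hb.dim
      rcases hj with h | h
      · have h1 := h.1; have h2 := h.2.1; omega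
      · have h1 := h.1; have h2 := h.2.1; omega

lemma eq_of_iso_III {X Y : Rep t ε} {i j i' j' : Fin t} {n n' : ℕ} (h : Data3 X i j n)
    (h' : Data3 Y i' j' n') (e : Nonempty (X ≅ Y)) : X = Y := by
  have b := data3_bij h
  have b' := data3_bij h'
  obtain ⟨hij, hn, hk, hd, hi, hj⟩ := h
  obtain ⟨hij', hn', hk', hd', hi', hj'⟩ := h'
  have bb : ∀ k, (k = i ∨ k = j) ↔ (k = i' ∨ k = j') := by
    intro k; rw [← b, ← b', bij_iff_of_iso e]
  have hj0 : j = j' := by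
    have h1 := (bb i).1 (Or.inl rfl)
    have h2 := (bb j).1 (Or.inr rfl)
    simp only [Fin.ext_iff, Fin.lt_def] at *
    omega
  subst hj0
  have hdd := dim_of_iso e
  refine rep_ext_ent hdd (fun k => ?_)
  by_cases hkj : k = j
  · subst hkj
    have e1 := hdd (tgt ε k)
    have e2 := hdd (src ε k)
    rcases hj with ⟨u1, u2, u3⟩ | ⟨u1, u2, u3⟩ <;> rcases hj' with ⟨v1, v2, v3⟩ | ⟨v1, v2, v3⟩
    · exact ent_congr e1 e2 (fun r s => if s = r + 1 then 1 else 0) u3 v3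
    · omega
    · omega
    · exact ent_congr e1 e2 (fun r s => if r = s + 1 then 1 else 0) u3 v3
  · exact ent_id_eq (hdd _) (hdd _) (hk k hkj) (hk' k hkj)

lemma eigen_eq {X Y : Rep t ε} {i : Fin t} {n n' : ℕ} {l l' : ℂ} (hn : 1 ≤ n)
    (hd : ∀ v, X.d v = n) (hd' : ∀ v, Y.d v = n')
    (hk : ∀ k, k ≠ i → EntryId (X.A k)) (hJ : EntryJ n l (X.A i))
    (hk' : ∀ k, k ≠ i → EntryId (Y.A k)) (hJ' : EntryJ n' l' (Y.A i))
    (e : Nonempty (X ≅ Y)) : l = l' := by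
  by_contra hne
  obtain ⟨e⟩ := e
  set g := e.hom
  have hnn : n = n' := by rw [← hd i, ← hd' i]; exact dim_of_iso ⟨e⟩ i
  subst hnn
  have hH : ∀ v, ent (cm g v) = ent (cm g i) :=
    const_one (ε := ε) (fun v => ent (cm g v)) i (fun k hki =>
      link_id_eq (hk k hki) (hk' k hki) (cm_comm g k) (by rw [hd, hd]) (by rw [hd', hd']))
  set f := ent (cm g i) with hf
  have hlink := link_J hJ hJ' (cm_comm g i)
  rw [hH (tgt ε i), hH (src ε i)] at hlink
  have hll : l - l' ≠ 0 := sub_ne_zero.2 hne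
  have hz : ∀ s k r, s < n → r + k = n → f r s = 0 := by
    intro s
    induction s with
    | zero =>
      intro k
      induction k with
      | zero => intro r _ hr; exact ent_out_row _ (by rw [hd']; omega)
      | succ k ih =>
        intro r hs hr
        have h1 := hlink r 0 (by omega) hs
        rw [ih (r + 1) hs (by omega)] at h1
        simp only [if_true, add_zero] at h1
        exact (mul_eq_zero.1 (show (l - l') * f r 0 = 0 by linear_combination h1)).resolve_left hll
    | succ s ihs =>
      intro k
      induction k with
      | zero => intro r _ hr; exact ent_out_row _ (by rw [hd']; omega)
      | succ k ih =>
        intro r hs hr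
        have h1 := hlink r (s + 1) (by omega) hs
        rw [ih (r + 1) hs (by omega)] at h1
        simp only [Nat.add_sub_cancel, Nat.succ_ne_zero, if_false, ihs (k + 1) r (by omega) hr,
          add_zero] at h1
        exact (mul_eq_zero.1 (show (l - l') * f r (s + 1) = 0 by
          linear_combination h1)).resolve_left hll
  have h0 : cm g i = 0 := by
    ext r s
    rw [← ent_fin (cm g i)]
    have h1 := hd i
    have h2 := hd' i
    exact hz s (n - r) r (by omega) (by omega)
  have h1 : cm (e.hom ≫ e.inv) i = 1 := by rw [e.hom_inv_id, cm_id]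
  rw [cm_comp, show cm e.hom i = 0 from h0, Matrix.mul_zero] at h1
  have h2 := congrFun (congrFun h1 ⟨0, by rw [hd]; exact hn⟩) ⟨0, by rw [hd]; exact hn⟩
  simp at h2

lemma J_bij {X : Rep t ε} {i : Fin t} {n : ℕ} (hn : 1 ≤ n)
    (hd : ∀ v, X.d v = n) (hk : ∀ k, k ≠ i → EntryId (X.A k)) (hJ : EntryJ n 0 (X.A i))
    (k : Fin t) : ¬ Bij (X.A k) ↔ k = i := by
  constructor
  · intro h
    by_contra hki
    exact h (bij_id (hk k hki) (by rw [hd, hd]))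
  · rintro rfl
    exact not_bij_J hJ hn

lemma eq_of_iso {X Y : Rep t ε} (hX : Canonical X) (hY : Canonical Y) (e : Nonempty (X ≅ Y)) :
    X = Y := by
  wlog H : (CanonicalI X) ∨ (CanonicalII X ∧ ¬ CanonicalI Y) ∨
    (CanonicalIII X ∧ CanonicalIII Y) generalizing X Y
  · refine (this hY hX (e.map fun e => e.symm) ?_).symm
    rcases hX with hX | hX | hX <;> rcases hY with hY | hY | hY <;> tauto
  have hB := bij_iff_of_iso e
  have hdd := dim_of_iso e
  have hIall : ∀ {Z : Rep t ε}, CanonicalI Z → ∀ k, Bij (Z.A k) := by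
    rintro Z ⟨i, n, l, hi, hn, hl, hd, hk, hJ⟩ k
    by_cases hki : k = i
    · subst hki; exact bij_J hJ hl
    · exact bij_id (hk k hki) (by rw [hd, hd])
  rcases H with hX | ⟨hX, hY'⟩ | ⟨hX, hY⟩
  · have hXa := hIall hX
    have hYa := fun k => (hB k).1 (hXa k)
    rcases hY with hY | hY | hY
    · obtain ⟨i, n, l, hi, hn, hl, hd, hk, hJ⟩ := hX
      obtain ⟨i', n', l', hi', hn', hl', hd', hk', hJ'⟩ := hY
      obtain rfl : i = i' := Fin.ext (by rw [hi, hi'])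
      obtain rfl := eigen_eq hn hd hd' hk hJ hk' hJ' e
      refine rep_ext_ent hdd (fun k => ?_)
      by_cases hki : k = i
      · subst hki
        exact ent_J_eq (hdd _) (hdd _) hJ hJ'
      · exact ent_id_eq (hdd _) (hdd _) (hk k hki) (hk' k hki)
    · obtain ⟨i', n', hn', hd', hk', hJ'⟩ := hY
      exact absurd (hYa i') (not_bij_J hJ' hn')
    · obtain ⟨i', j', n', h'⟩ := data3_of_canonicalIII hY
      exact absurd (hYa i') ((data3_bij h' i').2 (Or.inl rfl))
  · obtain ⟨i, n, hn, hd, hk, hJ⟩ := hX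
    have b := J_bij hn hd hk hJ
    rcases hY with hY | hY | hY
    · exact absurd hY hY'
    · obtain ⟨i', n', hn', hd', hk', hJ'⟩ := hY
      obtain rfl : i = i' := by
        rw [← J_bij hn' hd' hk' hJ', ← hB, b]
      refine rep_ext_ent hdd (fun k => ?_)
      by_cases hki : k = i
      · subst hki
        exact ent_J_eq (hdd _) (hdd _) hJ hJ'
      · exact ent_id_eq (hdd _) (hdd _) (hk k hki) (hk' k hki)
    · obtain ⟨i', j', n', h'⟩ := data3_of_canonicalIII hY
      have h1 : i' = i := by rw [← b, hB, data3_bij h']; exact Or.inl rfl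
      have h2 : j' = i := by rw [← b, hB, data3_bij h']; exact Or.inr rfl
      exact absurd h'.1 (by rw [h1, h2]; exact lt_irrefl _)
  · obtain ⟨i, j, n, h⟩ := data3_of_canonicalIII hX
    obtain ⟨i', j', n', h'⟩ := data3_of_canonicalIII hY
    exact eq_of_iso_III h h' e

end Canon

section Zigzag

/-- Linked vectors along one (possibly reversed) linear map. -/
def Lk {V U : Type} [AddCommGroup V] [Module ℂ V] [AddCommGroup U] [Module ℂ U]
    (c : (V →ₗ[ℂ] U) ⊕ (U →ₗ[ℂ] V)) (x : V) (y : U) : Prop :=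
  match c with
  | Sum.inl f => f x = y
  | Sum.inr g => g y = x

/-- Linked functionals along one (possibly reversed) linear map. -/
def DLk {V U : Type} [AddCommGroup V] [Module ℂ V] [AddCommGroup U] [Module ℂ U]
    (c : (V →ₗ[ℂ] U) ⊕ (U →ₗ[ℂ] V)) (x : V →ₗ[ℂ] ℂ) (y : U →ₗ[ℂ] ℂ) : Prop :=
  match c with
  | Sum.inl f => y ∘ₗ f = x
  | Sum.inr g => x ∘ₗ g = y

/-- Pull back a subspace along one (possibly reversed) linear map. -/
def pl {V U : Type} [AddCommGroup V] [Module ℂ V] [AddCommGroup U] [Module ℂ U]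
    (c : (V →ₗ[ℂ] U) ⊕ (U →ₗ[ℂ] V)) (K : Submodule ℂ U) : Submodule ℂ V :=
  match c with
  | Sum.inl f => K.comap f
  | Sum.inr g => K.map g

lemma mem_pl {V U : Type} [AddCommGroup V] [Module ℂ V] [AddCommGroup U] [Module ℂ U]
    (c : (V →ₗ[ℂ] U) ⊕ (U →ₗ[ℂ] V)) (K : Submodule ℂ U) (x : V) :
    x ∈ pl c K ↔ ∃ y ∈ K, Lk c x y := by
  rcases c with f | g
  · simp [pl, Lk]
  · simp [pl, Lk]

lemma pl_mono {V U : Type} [AddCommGroup V] [Module ℂ V] [AddCommGroup U] [Module ℂ U]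
    (c : (V →ₗ[ℂ] U) ⊕ (U →ₗ[ℂ] V)) {K K' : Submodule ℂ U} (h : K ≤ K') : pl c K ≤ pl c K' := by
  intro x
  rw [mem_pl, mem_pl]
  rintro ⟨y, hy, h'⟩
  exact ⟨y, h hy, h'⟩

lemma DLk.eval {V U : Type} [AddCommGroup V] [Module ℂ V] [AddCommGroup U] [Module ℂ U]
    {c : (V →ₗ[ℂ] U) ⊕ (U →ₗ[ℂ] V)} {f : V →ₗ[ℂ] ℂ} {f' : U →ₗ[ℂ] ℂ} {x : V} {y : U}
    (h : DLk c f f') (h' : Lk c x y) : f' y = f x := by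
  rcases c with φ | γ
  · simp only [DLk, Lk] at h h'
    rw [← h, ← h']; rfl
  · simp only [DLk, Lk] at h h'
    rw [← h, ← h']; rfl

/-- Extending a functional over one link. -/
lemma dlk_extend {V U : Type} [AddCommGroup V] [Module ℂ V] [AddCommGroup U] [Module ℂ U]
    (c : (V →ₗ[ℂ] U) ⊕ (U →ₗ[ℂ] V)) (K : Submodule ℂ U) (f : V →ₗ[ℂ] ℂ)
    (hf : ∀ x ∈ pl c K, f x = 0) : ∃ f' : U →ₗ[ℂ] ℂ, DLk c f f' ∧ ∀ y ∈ K, f' y = 0 := by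
  rcases c with φ | γ
  · simp only [pl, DLk] at *
    have h1 : f ∈ LinearMap.range (K.mkQ ∘ₗ φ).dualMap := by
      rw [LinearMap.range_dualMap_eq_dualAnnihilator_ker, Submodule.mem_dualAnnihilator]
      intro x hx
      apply hf
      simpa using hx
    obtain ⟨h, hh⟩ := h1
    refine ⟨h ∘ₗ K.mkQ, ?_, ?_⟩
    · rw [← hh]; rfl
    · intro y hy
      rw [LinearMap.comp_apply, Submodule.mkQ_apply, (Submodule.Quotient.mk_eq_zero K).2 hy, map_zero]
  · simp only [pl, DLk] at *
    refine ⟨f ∘ₗ γ, rfl, fun y hy => ?_⟩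
    exact hf _ (Submodule.mem_map_of_mem hy)

variable {W : ℕ → Type} [∀ p, AddCommGroup (W p)] [∀ p, Module ℂ (W p)]
  (c : ∀ p, (W p →ₗ[ℂ] W (p + 1)) ⊕ (W (p + 1) →ₗ[ℂ] W p))

/-- Iterated pull back of a subspace to the start of the walk. -/
def pull : ∀ n, Submodule ℂ (W n) → Submodule ℂ (W 0)
  | 0, K => K
  | (n + 1), K => pull n (pl (c n) K)

lemma pull_mono : ∀ (n : ℕ) {K K' : Submodule ℂ (W n)}, K ≤ K' → pull c n K ≤ pull c n K'
  | 0, _, _, h => h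
  | (n + 1), _, _, h => pull_mono n (pl_mono _ h)

lemma mem_pull (x : W 0) : ∀ (n : ℕ) (K : Submodule ℂ (W n)), x ∈ pull c n K ↔
    ∃ xs : ∀ p, W p, xs 0 = x ∧ xs n ∈ K ∧ ∀ p < n, Lk (c p) (xs p) (xs (p + 1)) := by
  intro n
  induction n with
  | zero =>
    intro K
    constructor
    · intro h
      exact ⟨Function.update (fun _ => 0) 0 x, by simp, by simpa [pull] using h, by simp⟩
    · rintro ⟨xs, rfl, h, -⟩
      exact h
  | succ n ih =>
    intro K
    rw [pull, ih]
    constructor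
    · rintro ⟨xs, h0, hn, hl⟩
      rw [mem_pl] at hn
      obtain ⟨y, hy, hxy⟩ := hn
      refine ⟨Function.update xs (n + 1) y, ?_, by simpa using hy, ?_⟩
      · rw [Function.update_of_ne (by omega), h0]
      · intro p hp
        rw [Function.update_of_ne (show p ≠ n + 1 by omega)]
        rcases Nat.lt_succ_iff_lt_or_eq.1 hp with h | rfl
        · rw [Function.update_of_ne (show p + 1 ≠ n + 1 by omega)]
          exact hl p h
        · rw [Function.update_self]; exact hxy
    · rintro ⟨xs, h0, hn, hl⟩
      refine ⟨xs, h0, ?_, fun p hp => hl p (by omega)⟩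
      rw [mem_pl]
      exact ⟨_, hn, hl n (by omega)⟩

lemma dual_walk (f : W 0 →ₗ[ℂ] ℂ) : ∀ (n : ℕ) (K : Submodule ℂ (W n)),
    (∀ x ∈ pull c n K, f x = 0) → ∃ fs : ∀ p, W p →ₗ[ℂ] ℂ, fs 0 = f ∧ (∀ y ∈ K, fs n y = 0) ∧
      ∀ p < n, DLk (c p) (fs p) (fs (p + 1)) := by
  intro n
  induction n with
  | zero =>
    intro K h
    exact ⟨Function.update (fun _ => 0) 0 f, by simp, by simpa [pull] using h, by simp⟩
  | succ n ih =>
    intro K h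
    obtain ⟨fs, h0, hn, hl⟩ := ih _ h
    obtain ⟨f', h1, h2⟩ := dlk_extend (c n) K (fs n) hn
    refine ⟨Function.update fs (n + 1) f', ?_, by simpa using h2, ?_⟩
    · rw [Function.update_of_ne (by omega), h0]
    · intro p hp
      rw [Function.update_of_ne (show p ≠ n + 1 by omega)]
      rcases Nat.lt_succ_iff_lt_or_eq.1 hp with h | rfl
      · rw [Function.update_of_ne (show p + 1 ≠ n + 1 by omega)]
        exact hl p h
      · rw [Function.update_self]; exact h1

/-- End conditions for a string: either the vector is killed or the functional kills. -/
def EndC {V U : Type} [AddCommGroup V] [Module ℂ V] [AddCommGroup U] [Module ℂ U]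
    (c : (V →ₗ[ℂ] U) ⊕ (U →ₗ[ℂ] V)) (x : V) (f : V →ₗ[ℂ] ℂ) : Prop :=
  match c with
  | Sum.inl φ => φ x = 0
  | Sum.inr γ => f ∘ₗ γ = 0

lemma find_string (Rm Rp : Submodule ℂ (W 0)) (hR : Rm < Rp) (N : ℕ)
    (hN : pull c N ⊤ ⊓ Rp ≤ pull c N ⊥ ⊔ Rm) :
    ∃ (n : ℕ) (xs : ∀ p, W p) (fs : ∀ p, W p →ₗ[ℂ] ℂ), xs 0 ∈ Rp ∧ (∀ r ∈ Rm, fs 0 r = 0) ∧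
      (∀ p < n, Lk (c p) (xs p) (xs (p + 1))) ∧ (∀ p < n, DLk (c p) (fs p) (fs (p + 1))) ∧
      EndC (c n) (xs n) (fs n) ∧ ∀ p ≤ n, fs p (xs p) ≠ 0 := by
  classical
  have h0 : ¬ (pull c 0 ⊤ ⊓ Rp ≤ pull c 0 ⊥ ⊔ Rm) := by
    simp only [pull, top_inf_eq, bot_sup_eq]
    exact not_le_of_gt hR
  obtain ⟨n, hn, hn1⟩ : ∃ n, ¬ (pull c n ⊤ ⊓ Rp ≤ pull c n ⊥ ⊔ Rm) ∧
      (pull c (n + 1) ⊤ ⊓ Rp ≤ pull c (n + 1) ⊥ ⊔ Rm) := by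
    by_contra hcon
    push Not at hcon
    have : ∀ n, ¬ (pull c n ⊤ ⊓ Rp ≤ pull c n ⊥ ⊔ Rm) := by
      intro n
      induction n with
      | zero => exact h0
      | succ n ih => exact hcon n ih
    exact this N hN
  have hRle := hR.le
  -- the pair of subspaces at the end of the string
  obtain ⟨Kp, Km, hK, x, hx1, hx2, hx3⟩ : ∃ Kp Km : Submodule ℂ (W n),
      (∀ (y : W n) (f : W n →ₗ[ℂ] ℂ), y ∈ Kp → (∀ z ∈ Km, f z = 0) → EndC (c n) y f) ∧
      ∃ x, x ∈ pull c n Kp ∧ x ∈ Rp ∧ x ∉ pull c n Km ⊔ Rm := by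
    obtain ⟨x, ⟨hx1, hx2⟩, hx3⟩ := SetLike.not_le_iff_exists.1 hn
    simp only [pull] at hn1
    rcases hc : c n with φ | γ
    · rw [hc] at hn1
      refine ⟨LinearMap.ker φ, ⊥, fun y f hy _ => by simpa [EndC] using hy, ?_⟩
      have h2 : x ∈ pull c n ⊤ ⊓ Rp := ⟨hx1, hx2⟩
      have h3 := hn1 (by simpa [pl] using h2)
      obtain ⟨y, hy, r, hr, rfl⟩ := Submodule.mem_sup.1 h3
      refine ⟨y, hy, ?_, ?_⟩
      · simpa using Rp.sub_mem hx2 (hRle hr)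
      · intro h
        exact hx3 (Submodule.add_mem _ h (Submodule.mem_sup_right hr))
    · rw [hc] at hn1
      refine ⟨⊤, LinearMap.range γ, fun y f _ hf => ?_, x, hx1, hx2, ?_⟩
      · simp only [EndC]
        ext z
        exact hf _ ⟨z, rfl⟩
      · intro h
        obtain ⟨y, hy, r, hr, rfl⟩ := Submodule.mem_sup.1 h
        have h3 := hn1 ⟨show y ∈ pull c n (pl (Sum.inr γ) ⊤) by simpa [pl] using hy,
          show y ∈ Rp by simpa using Rp.sub_mem hx2 (hRle hr)⟩
        have h4 : y ∈ pull c n ⊥ ⊔ Rm := by simpa [pl] using h3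
        exact hx3 (Submodule.add_mem _ h4 (Submodule.mem_sup_right hr))
  obtain ⟨f, hf, hfK⟩ := Submodule.exists_le_ker_of_notMem hx3
  obtain ⟨xs, xs0, xsn, xsl⟩ := (mem_pull c x n Kp).1 hx1
  obtain ⟨fs, fs0, fsn, fsl⟩ := dual_walk c f n Km
    (fun z hz => by simpa using hfK (Submodule.mem_sup_left hz))
  refine ⟨n, xs, fs, by rwa [xs0], ?_, xsl, fsl, hK _ _ xsn fsn, ?_⟩
  · intro r hr
    rw [fs0]
    simpa using hfK (Submodule.mem_sup_right hr)
  · intro p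
    induction p with
    | zero => intro _; rw [xs0, fs0]; exact hf
    | succ p ih =>
      intro hp
      rw [(fsl p (by omega)).eval (xsl p (by omega))]
      exact ih (by omega)

lemma pull_bot_mono {m n : ℕ} (h : m ≤ n) : pull c m ⊥ ≤ pull c n ⊥ := by
  induction n, h using Nat.le_induction with
  | base => exact le_rfl
  | succ n _ ih => exact ih.trans (pull_mono c n bot_le)

end Zigzag

section WalkS

/-- The space at a vertex. -/
abbrev VS (X : Rep t ε) (v : Fin t) : Type := Fin (X.d v) → ℂ

/-- The arrow `i` as a linear map between the spaces at `v` and `w`. -/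
noncomputable def fwd (X : Rep t ε) (i v w : Fin t) : VS X v →ₗ[ℂ] VS X w :=
  if h : src ε i = v ∧ tgt ε i = w then by
    obtain ⟨rfl, rfl⟩ := h
    exact (X.A i).mulVecLin
  else 0

lemma fwd_self (X : Rep t ε) (i : Fin t) : fwd X i (src ε i) (tgt ε i) = (X.A i).mulVecLin := by
  rw [fwd, dif_pos ⟨rfl, rfl⟩]

lemma fwd_iff (X : Rep t ε) {i v w : Fin t} (h1 : src ε i = v) (h2 : tgt ε i = w)
    (x y : ∀ v, VS X v) : fwd X i v w (x v) = y w ↔ X.A i *ᵥ x (src ε i) = y (tgt ε i) := by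
  subst h1 h2
  rw [fwd_self]; rfl

lemma fwd_dual_iff (X : Rep t ε) {i v w : Fin t} (h1 : src ε i = v) (h2 : tgt ε i = w)
    (x y : ∀ v, VS X v →ₗ[ℂ] ℂ) :
    (y w) ∘ₗ fwd X i v w = x v ↔ (y (tgt ε i)) ∘ₗ (X.A i).mulVecLin = x (src ε i) := by
  subst h1 h2
  rw [fwd_self]

/-- A walk around the cycle. -/
structure Walk (ε : Fin t → Bool) where
  u : ℕ → Fin t
  e : ℕ → Fin t
  b : ℕ → Bool
  ht : 0 < t
  hb : ∀ p, b p = true → src ε (e p) = u p ∧ tgt ε (e p) = u (p + 1)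
  hb' : ∀ p, b p = false → src ε (e p) = u (p + 1) ∧ tgt ε (e p) = u p
  pu : ∀ p, u (p + t) = u p
  pe : ∀ p, e (p + t) = e p
  pb : ∀ p, b (p + t) = b p

variable (w : Walk ε) (X : Rep t ε)

/-- The link data of a walk. -/
noncomputable def cW (p : ℕ) : (VS X (w.u p) →ₗ[ℂ] VS X (w.u (p + 1))) ⊕
    (VS X (w.u (p + 1)) →ₗ[ℂ] VS X (w.u p)) :=
  if w.b p = true then Sum.inl (fwd X (w.e p) (w.u p) (w.u (p + 1)))
  else Sum.inr (fwd X (w.e p) (w.u (p + 1)) (w.u p))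

/-- Links for global families. -/
def LkG (X : Rep t ε) (i : Fin t) (b : Bool) (x y : ∀ v, VS X v) : Prop :=
  if b = true then X.A i *ᵥ x (src ε i) = y (tgt ε i) else X.A i *ᵥ y (src ε i) = x (tgt ε i)

lemma lk_iff (p : ℕ) (x y : ∀ v, VS X v) :
    Lk (cW w X p) (x (w.u p)) (y (w.u (p + 1))) ↔ LkG X (w.e p) (w.b p) x y := by
  unfold cW LkG
  by_cases hb : w.b p = true
  · rw [if_pos hb, if_pos hb, ← fwd_iff X (w.hb p hb).1 (w.hb p hb).2]
    rfl
  · rw [if_neg hb, if_neg hb]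
    rw [Bool.not_eq_true] at hb
    rw [← fwd_iff X (w.hb' p hb).1 (w.hb' p hb).2]
    rfl

lemma lkG_zero (i : Fin t) (b : Bool) : LkG X i b 0 0 := by
  unfold LkG; split_ifs <;> simp

lemma lkG_add (i : Fin t) (b : Bool) (x y x' y' : ∀ v, VS X v) (h : LkG X i b x y)
    (h' : LkG X i b x' y') : LkG X i b (x + x') (y + y') := by
  unfold LkG at *
  split_ifs at * <;> simp [Matrix.mulVec_add, h, h']

lemma lkG_smul (i : Fin t) (b : Bool) (x y : ∀ v, VS X v) (a : ℂ) (h : LkG X i b x y) :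
    LkG X i b (a • x) (a • y) := by
  unfold LkG at *
  split_ifs at * <;> simp [Matrix.mulVec_smul, h]

lemma lkG_sum (i : Fin t) (b : Bool) (s : Finset ℕ) (c : ℕ → ℂ) (x y : ℕ → ∀ v, VS X v)
    (h : ∀ k ∈ s, LkG X i b (x k) (y k)) :
    LkG X i b (∑ k ∈ s, c k • x k) (∑ k ∈ s, c k • y k) := by
  classical
  induction s using Finset.induction_on with
  | empty => simpa using lkG_zero X i b
  | insert k s hk ih =>
    rw [Finset.sum_insert hk, Finset.sum_insert hk]
    exact lkG_add _ _ _ _ _ _ _ (lkG_smul _ _ _ _ _ _ (h k (by simp)))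
      (ih (fun k hk => h k (by simp [hk])))

lemma Walk.pu' (k p : ℕ) : w.u (p + t * k) = w.u p := by
  induction k with
  | zero => rfl
  | succ k ih => rw [Nat.mul_succ, ← add_assoc, w.pu, ih]

lemma Walk.pe' (k p : ℕ) : w.e (p + t * k) = w.e p := by
  induction k with
  | zero => rfl
  | succ k ih => rw [Nat.mul_succ, ← add_assoc, w.pe, ih]

lemma Walk.pb' (k p : ℕ) : w.b (p + t * k) = w.b p := by
  induction k with
  | zero => rfl
  | succ k ih => rw [Nat.mul_succ, ← add_assoc, w.pb, ih]

lemma exists_family (xs : ∀ p, VS X (w.u p)) : ∃ ys : ℕ → ∀ v, VS X v, ∀ p, ys p (w.u p) = xs p :=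
  ⟨fun p => Function.update 0 (w.u p) (xs p), fun p => by simp⟩

lemma exists_family_dual (xs : ∀ p, VS X (w.u p) →ₗ[ℂ] ℂ) :
    ∃ ys : ℕ → ∀ v, VS X v →ₗ[ℂ] ℂ, ∀ p, ys p (w.u p) = xs p :=
  ⟨fun p => Function.update 0 (w.u p) (xs p), fun p => by simp⟩

lemma lin_dep {D : ℕ} (y : ℕ → Fin D → ℂ) : ∃ c : ℕ → ℂ,
    ∑ k ∈ Finset.range (D + 1), c k • y k = 0 ∧ ∃ k, k ≤ D ∧ c k ≠ 0 := by
  have h : ¬ LinearIndependent ℂ (fun k : Fin (D + 1) => y k) := by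
    intro h
    have := h.fintype_card_le_finrank
    simp at this
  obtain ⟨g, hg, i, hi⟩ := Fintype.not_linearIndependent_iff.1 h
  refine ⟨fun k => if h : k < D + 1 then g ⟨k, h⟩ else 0, ?_, i, by omega, by
    beta_reduce; rw [dif_pos i.2]; exact hi⟩
  rw [Finset.sum_range]
  rw [← hg]
  apply Finset.sum_congr rfl
  intro k _
  beta_reduce
  rw [dif_pos k.2]

lemma lin_dep_last {D : ℕ} (y : ℕ → Fin D → ℂ) : ∃ (c : ℕ → ℂ) (m : ℕ), m ≤ D ∧ c m ≠ 0 ∧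
    ∑ k ∈ Finset.range (m + 1), c k • y k = 0 := by
  classical
  obtain ⟨c, hc, k, hk, hk0⟩ := lin_dep y
  have hm := Nat.findGreatest_spec (P := fun k => c k ≠ 0) hk hk0
  refine ⟨c, Nat.findGreatest (fun k => c k ≠ 0) D, Nat.findGreatest_le D, hm, ?_⟩
  rw [← hc]
  apply Finset.sum_subset
  · intro a
    have := Nat.findGreatest_le (P := fun k => c k ≠ 0) D
    simp only [Finset.mem_range]; omega
  · intro a ha hna
    simp only [Finset.mem_range] at ha hna
    have := Nat.findGreatest_is_greatest (P := fun k => c k ≠ 0) (n := D) (k := a)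
      (by omega) (by omega)
    simp only [ne_eq, not_not] at this
    rw [this, zero_smul]

lemma lin_dep_first {D : ℕ} (y : ℕ → Fin D → ℂ) : ∃ (c : ℕ → ℂ) (m : ℕ), m ≤ D ∧ c 0 ≠ 0 ∧
    ∑ k ∈ Finset.range (D - m + 1), c k • y (m + k) = 0 := by
  classical
  obtain ⟨c, hc, k, hk, hk0⟩ := lin_dep y
  have hex : ∃ k, c k ≠ 0 := ⟨k, hk0⟩
  have hmk : Nat.find hex ≤ D := (Nat.find_min' hex hk0).trans hk
  refine ⟨fun k => c (Nat.find hex + k), Nat.find hex, hmk, Nat.find_spec hex, ?_⟩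
  rw [← hc]
  conv_rhs => rw [show D + 1 = Nat.find hex + (D - Nat.find hex + 1) by omega, Finset.sum_range_add]
  rw [Finset.sum_eq_zero (s := Finset.range (Nat.find hex)), zero_add]
  intro a ha
  have := Nat.find_min hex (Finset.mem_range.1 ha)
  simp only [ne_eq, not_not] at this
  rw [this, zero_smul]

lemma walk_ker (hb : w.b (t - 1) = false) :
    pull (cW w X) (t * X.d (w.u 0)) ⊤ ⊓
      LinearMap.ker (fwd X (w.e (t - 1)) (w.u 0) (w.u (t - 1))) ≤
    pull (cW w X) (t * X.d (w.u 0)) ⊥ ⊔ ⊥ := by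
  have ht := w.ht
  rintro x ⟨hx, hx'⟩
  obtain ⟨xs, xs0, -, hl⟩ := (mem_pull _ _ _ _).1 hx
  obtain ⟨ys, hys⟩ := exists_family w X xs
  have hl' : ∀ p < t * X.d (w.u 0), LkG X (w.e p) (w.b p) (ys p) (ys (p + 1)) := by
    intro p hp
    rw [← lk_iff, hys, hys]
    exact hl p hp
  obtain ⟨c, m, hm, hcm, hsum⟩ := lin_dep_last (fun k => ys (t * k) (w.u 0))
  have hmN : t * m ≤ t * X.d (w.u 0) := Nat.mul_le_mul_left t hm
  have hu : w.u (t - 1 + 1) = w.u 0 := by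
    rw [Nat.sub_add_cancel ht]; simpa using w.pu 0
  have hker : X.A (w.e (t - 1)) *ᵥ ys 0 (src ε (w.e (t - 1))) = 0 := by
    have h1 := w.hb' _ hb
    have h2 := (fwd_iff X (h1.1.trans hu) h1.2 (ys 0) 0).1 (by
      rw [hys 0, xs0]; exact hx')
    exact h2
  let z : ℕ → ∀ v, VS X v := fun p => ∑ k ∈ Finset.range (m + 1),
    c k • (if t * (m - k) ≤ p then ys (p - t * (m - k)) else 0)
  have hz : ∀ p < t * m, LkG X (w.e p) (w.b p) (z p) (z (p + 1)) := by
    intro p hp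
    apply lkG_sum
    intro k hk
    rcases Nat.lt_trichotomy (p + 1) (t * (m - k)) with h | h | h
    · rw [if_neg (by omega), if_neg (by omega)]
      exact lkG_zero _ _ _
    · rw [if_neg (by omega), if_pos (by omega), h, Nat.sub_self]
      obtain ⟨a, ha⟩ : ∃ a, m - k = a + 1 := by
        rcases hmk : m - k with _ | a
        · rw [hmk] at h; simp at h
        · exact ⟨a, rfl⟩
      have hp' : p = t - 1 + t * a := by
        rw [ha, Nat.mul_succ] at h; omega
      rw [hp', w.pe', w.pb', hb]
      unfold LkG
      simpa using hker
    · obtain ⟨a, rfl⟩ : ∃ a, p = a + t * (m - k) := ⟨p - t * (m - k), by omega⟩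
      rw [if_pos (by omega), if_pos (by omega), w.pe', w.pb', Nat.add_sub_cancel,
        show a + t * (m - k) + 1 - t * (m - k) = a + 1 by omega]
      exact hl' a (by omega)
  have hz0 : z 0 = c m • ys 0 := by
    simp only [z]
    rw [Finset.sum_eq_single m]
    · simp
    · intro k hk hkm
      have : k < m := by have := Finset.mem_range.1 hk; omega
      have : 0 < t * (m - k) := Nat.mul_pos ht (by omega)
      rw [if_neg (by omega), smul_zero]
    · simp
  have hzm : ∀ v, v = w.u 0 → z (t * m) v = 0 := by
    rintro v rfl
    rw [← hsum]
    simp only [z, Finset.sum_apply, Pi.smul_apply]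
    apply Finset.sum_congr rfl
    intro k hk
    have hk := Finset.mem_range.1 hk
    obtain ⟨a, rfl⟩ : ∃ a, m = k + a := ⟨m - k, by omega⟩
    have h1 : t * (k + a - k) ≤ t * (k + a) := Nat.mul_le_mul_left t (by omega)
    rw [if_pos h1]
    congr 3
    rw [Nat.add_sub_cancel_left, Nat.mul_add]; omega
  have hmem : c m • x ∈ pull (cW w X) (t * m) ⊥ := by
    rw [mem_pull]
    refine ⟨fun p => z p (w.u p), ?_, ?_, ?_⟩
    · simp only [hz0, Pi.smul_apply, hys, xs0]
    · rw [Submodule.mem_bot]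
      exact hzm _ (by simpa using w.pu' m 0)
    · intro p hp
      rw [lk_iff]
      exact hz p hp
  rw [sup_bot_eq]
  have h3 := pull_bot_mono (cW w X) hmN hmem
  rwa [Submodule.smul_mem_iff _ hcm] at h3

lemma walk_coker (hb : w.b (t - 1) = true) :
    pull (cW w X) (t * X.d (w.u 0)) ⊤ ⊓ ⊤ ≤ pull (cW w X) (t * X.d (w.u 0)) ⊥ ⊔
      LinearMap.range (fwd X (w.e (t - 1)) (w.u (t - 1)) (w.u 0)) := by
  have ht := w.ht
  rintro x ⟨hx, -⟩
  obtain ⟨xs, xs0, -, hl⟩ := (mem_pull _ _ _ _).1 hx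
  obtain ⟨ys, hys⟩ := exists_family w X xs
  have hl' : ∀ p < t * X.d (w.u 0), LkG X (w.e p) (w.b p) (ys p) (ys (p + 1)) := by
    intro p hp
    rw [← lk_iff, hys, hys]
    exact hl p hp
  obtain ⟨c, m, hm, hcm, hsum⟩ := lin_dep_first (fun k => ys (t * k) (w.u 0))
  have hmN : t * m ≤ t * X.d (w.u 0) := Nat.mul_le_mul_left t hm
  have hu : w.u (t - 1 + 1) = w.u 0 := by
    rw [Nat.sub_add_cancel ht]; simpa using w.pu 0
  have h1 := w.hb _ hb
  have hrange : ∀ k, k + 1 ≤ X.d (w.u 0) → ys (t * (k + 1)) (w.u 0) ∈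
      LinearMap.range (fwd X (w.e (t - 1)) (w.u (t - 1)) (w.u 0)) := by
    intro k hk
    have hle : t * (k + 1) ≤ t * X.d (w.u 0) := Nat.mul_le_mul_left t hk
    rw [Nat.mul_succ] at hle ⊢
    have h2 := hl' (t - 1 + t * k) (by omega)
    rw [w.pe', w.pb', hb, show t - 1 + t * k + 1 = t * k + t by omega] at h2
    unfold LkG at h2
    rw [if_pos rfl] at h2
    rw [← fwd_iff X h1.1 (h1.2.trans hu)] at h2
    exact ⟨_, h2⟩
  let z : ℕ → ∀ v, VS X v := fun p => ∑ k ∈ Finset.range (X.d (w.u 0) - m + 1),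
    c k • ys (p + t * k)
  have hz : ∀ p < t * m, LkG X (w.e p) (w.b p) (z p) (z (p + 1)) := by
    intro p hp
    apply lkG_sum
    intro k hk
    have hk := Finset.mem_range.1 hk
    have h2 : t * (m + k) ≤ t * X.d (w.u 0) := Nat.mul_le_mul_left t (by omega)
    rw [Nat.mul_add] at h2
    have h3 := hl' (p + t * k) (by omega)
    rw [w.pe', w.pb'] at h3
    rw [show p + 1 + t * k = p + t * k + 1 by omega]
    exact h3
  have hzm : ∀ v, v = w.u 0 → z (t * m) v = 0 := by
    rintro v rfl
    rw [← hsum]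
    simp only [z, Finset.sum_apply, Pi.smul_apply, Nat.mul_add]
  have hmem : z 0 (w.u 0) ∈ pull (cW w X) (t * m) ⊥ := by
    rw [mem_pull]
    refine ⟨fun p => z p (w.u p), rfl, ?_, ?_⟩
    · rw [Submodule.mem_bot]
      exact hzm _ (by simpa using w.pu' m 0)
    · intro p hp
      rw [lk_iff]
      exact hz p hp
  have h3 := pull_bot_mono (cW w X) hmN hmem
  have h4 : z 0 (w.u 0) = ∑ k ∈ Finset.range (X.d (w.u 0) - m), c (k + 1) • ys (t * (k + 1)) (w.u 0)
      + c 0 • x := by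
    simp only [z, Finset.sum_apply, Pi.smul_apply, zero_add]
    rw [Finset.sum_range_succ', Nat.mul_zero, hys, xs0]
  have h5 : ∑ k ∈ Finset.range (X.d (w.u 0) - m), c (k + 1) • ys (t * (k + 1)) (w.u 0) ∈
      LinearMap.range (fwd X (w.e (t - 1)) (w.u (t - 1)) (w.u 0)) := by
    apply Submodule.sum_mem
    intro k hk
    have hk := Finset.mem_range.1 hk
    exact Submodule.smul_mem _ _ (hrange k (by omega))
  have h6 : c 0 • x ∈ pull (cW w X) (t * X.d (w.u 0)) ⊥ ⊔
      LinearMap.range (fwd X (w.e (t - 1)) (w.u (t - 1)) (w.u 0)) := by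
    rw [eq_sub_of_add_eq' h4.symm]
    exact Submodule.sub_mem _ (Submodule.mem_sup_left h3) (Submodule.mem_sup_right h5)
  rwa [Submodule.smul_mem_iff _ hcm] at h6

/-- A string of vectors and functionals along a walk. -/
structure WStr (n : ℕ) (y : ℕ → ∀ v, VS X v) (g : ℕ → ∀ v, VS X v →ₗ[ℂ] ℂ) : Prop where
  s1 : w.b (t - 1) = false → X.A (w.e (t - 1)) *ᵥ y 0 (src ε (w.e (t - 1))) = 0
  s2 : w.b (t - 1) = true →
    g 0 (tgt ε (w.e (t - 1))) ∘ₗ (X.A (w.e (t - 1))).mulVecLin = 0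
  l1 : ∀ p < n, w.b p = true → X.A (w.e p) *ᵥ y p (src ε (w.e p)) = y (p + 1) (tgt ε (w.e p))
  l2 : ∀ p < n, w.b p = false → X.A (w.e p) *ᵥ y (p + 1) (src ε (w.e p)) = y p (tgt ε (w.e p))
  l3 : ∀ p < n, w.b p = true →
    g (p + 1) (tgt ε (w.e p)) ∘ₗ (X.A (w.e p)).mulVecLin = g p (src ε (w.e p))
  l4 : ∀ p < n, w.b p = false →
    g p (tgt ε (w.e p)) ∘ₗ (X.A (w.e p)).mulVecLin = g (p + 1) (src ε (w.e p))
  e1 : w.b n = true → X.A (w.e n) *ᵥ y n (src ε (w.e n)) = 0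
  e2 : w.b n = false → g n (tgt ε (w.e n)) ∘ₗ (X.A (w.e n)).mulVecLin = 0
  nz : ∀ p ≤ n, g p (w.u p) (y p (w.u p)) ≠ 0

lemma exists_wstr
    (h : (w.b (t - 1) = false ∧ ∃ x, x ≠ 0 ∧ X.A (w.e (t - 1)) *ᵥ x = 0) ∨
      (w.b (t - 1) = true ∧ ∃ z, ∀ x, X.A (w.e (t - 1)) *ᵥ x ≠ z)) :
    ∃ n y g, WStr w X n y g := by
  have ht := w.ht
  have hu : w.u (t - 1 + 1) = w.u 0 := by
    rw [Nat.sub_add_cancel ht]; simpa using w.pu 0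
  obtain ⟨n, xs, fs, hs1, hs2, hl, hdl, hend, hnz⟩ : ∃ (n : ℕ) (xs : ∀ p, VS X (w.u p))
      (fs : ∀ p, VS X (w.u p) →ₗ[ℂ] ℂ),
      (w.b (t - 1) = false → fwd X (w.e (t - 1)) (w.u 0) (w.u (t - 1)) (xs 0) = 0) ∧
      (w.b (t - 1) = true → fs 0 ∘ₗ fwd X (w.e (t - 1)) (w.u (t - 1)) (w.u 0) = 0) ∧
      (∀ p < n, Lk (cW w X p) (xs p) (xs (p + 1))) ∧
      (∀ p < n, DLk (cW w X p) (fs p) (fs (p + 1))) ∧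
      EndC (cW w X n) (xs n) (fs n) ∧ ∀ p ≤ n, fs p (xs p) ≠ 0 := by
    rcases h with ⟨hb, x, hx0, hx⟩ | ⟨hb, z, hz⟩
    · have h1 := w.hb' _ hb
      obtain ⟨n, xs, fs, h2, h3, h4, h5, h6, h7⟩ := find_string (cW w X) ⊥
        (LinearMap.ker (fwd X (w.e (t - 1)) (w.u 0) (w.u (t - 1)))) (by
          rw [bot_lt_iff_ne_bot, Submodule.ne_bot_iff]
          obtain ⟨y, hy⟩ : ∃ y : ∀ v, VS X v, y (src ε (w.e (t - 1))) = x :=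
            ⟨Function.update 0 _ x, by simp⟩
          refine ⟨y (w.u 0), ?_, ?_⟩
          · rw [LinearMap.mem_ker]
            refine (fwd_iff X (h1.1.trans hu) h1.2 y 0).2 ?_
            rw [hy, hx]; rfl
          · have : ∀ v, v = src ε (w.e (t - 1)) → y v ≠ 0 := by
              rintro v rfl; rwa [hy]
            exact this _ (h1.1.trans hu).symm) _ (walk_ker w X hb)
      exact ⟨n, xs, fs, fun _ => h2, fun h => by simp [hb] at h, h4, h5, h6, h7⟩
    · have h1 := w.hb _ hb
      obtain ⟨n, xs, fs, h2, h3, h4, h5, h6, h7⟩ := find_string (cW w X)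
        (LinearMap.range (fwd X (w.e (t - 1)) (w.u (t - 1)) (w.u 0))) ⊤ (by
          rw [lt_top_iff_ne_top]
          intro htop
          obtain ⟨y, hy⟩ : ∃ y : ∀ v, VS X v, y (tgt ε (w.e (t - 1))) = z :=
            ⟨Function.update 0 _ z, by simp⟩
          obtain ⟨x, hx⟩ : y (w.u 0) ∈
            LinearMap.range (fwd X (w.e (t - 1)) (w.u (t - 1)) (w.u 0)) := by rw [htop]; trivial
          obtain ⟨x', hx'⟩ : ∃ y : ∀ v, VS X v, y (w.u (t - 1)) = x :=
            ⟨Function.update 0 _ x, by simp⟩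
          rw [← hx'] at hx
          have := (fwd_iff X h1.1 (h1.2.trans hu) x' y).1 hx
          rw [hy] at this
          exact hz _ this) _ (walk_coker w X hb)
      exact ⟨n, xs, fs, fun h => by simp [hb] at h, fun _ => LinearMap.ext fun r =>
        h3 _ ⟨r, rfl⟩, h4, h5, h6, h7⟩
  obtain ⟨y, hy⟩ := exists_family w X xs
  obtain ⟨g, hg⟩ := exists_family_dual w X fs
  refine ⟨n, y, g, ?_, ?_, ?_, ?_, ?_, ?_, ?_, ?_, ?_⟩
  · intro hb
    have h1 := w.hb' _ hb
    refine (fwd_iff X (h1.1.trans hu) h1.2 (y 0) 0).1 ?_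
    rw [hy]; exact hs1 hb
  · intro hb
    have h1 := w.hb _ hb
    refine (fwd_dual_iff X h1.1 (h1.2.trans hu) 0 (g 0)).1 ?_
    rw [hg]; exact hs2 hb
  · intro p hp hb
    have h1 := hl p hp
    rw [← hy, ← hy, lk_iff, LkG, if_pos hb] at h1
    exact h1
  · intro p hp hb
    have h1 := hl p hp
    rw [← hy, ← hy, lk_iff, LkG, if_neg (by simp [hb])] at h1
    exact h1
  · intro p hp hb
    have h1 := hdl p hp
    rw [← hg, ← hg, cW, if_pos hb] at h1
    exact (fwd_dual_iff X (w.hb p hb).1 (w.hb p hb).2 _ _).1 h1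
  · intro p hp hb
    have h1 := hdl p hp
    rw [← hg, ← hg, cW, if_neg (by simp [hb])] at h1
    exact (fwd_dual_iff X (w.hb' p hb).1 (w.hb' p hb).2 _ _).1 h1
  · intro hb
    rw [← hy, ← hg, cW, if_pos hb] at hend
    exact (fwd_iff X (w.hb n hb).1 (w.hb n hb).2 _ 0).1 hend
  · intro hb
    rw [← hy, ← hg, cW, if_neg (by simp [hb])] at hend
    exact (fwd_dual_iff X (w.hb' n hb).1 (w.hb' n hb).2 0 _).1 hend
  · intro p hp
    rw [hy, hg]
    exact hnz p hp

end WalkS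

section StringData

/-- A clockwise string of vectors and functionals in a representation, starting at `a`. -/
structure SD (X : Rep t ε) (a n : ℕ) (y : ℕ → ∀ v, VS X v) (g : ℕ → ∀ v, VS X v →ₗ[ℂ] ℂ) :
    Prop where
  r1 : ∀ p ≤ n, ∀ i : Fin t, (i : ℕ) = (a + p) % t → ε i = true →
    X.A i *ᵥ y p (src ε i) = if p < n then y (p + 1) (tgt ε i) else 0
  r2 : ∀ p ≤ n, ∀ i : Fin t, (next i : ℕ) = (a + p) % t → ε i = false →
    X.A i *ᵥ y p (src ε i) = if p = 0 then 0 else y (p - 1) (tgt ε i)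
  r3 : ∀ p ≤ n, ∀ i : Fin t, (next i : ℕ) = (a + p) % t → ε i = true →
    g p (tgt ε i) ∘ₗ (X.A i).mulVecLin = if p = 0 then 0 else g (p - 1) (src ε i)
  r4 : ∀ p ≤ n, ∀ i : Fin t, (i : ℕ) = (a + p) % t → ε i = false →
    g p (tgt ε i) ∘ₗ (X.A i).mulVecLin = if p < n then g (p + 1) (src ε i) else 0
  nz : ∀ p ≤ n, ∀ v : Fin t, (v : ℕ) = (a + p) % t → g p v (y p v) ≠ 0

lemma next_inj {i j : Fin t} (h : next i = next j) : i = j := by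
  have h1 := congrArg Fin.val h
  simp only [next] at h1
  have hi := i.2
  have hj := j.2
  apply Fin.ext
  rcases Nat.lt_or_ge (i + 1) t with h2 | h2 <;> rcases Nat.lt_or_ge (j + 1) t with h3 | h3
  · rw [Nat.mod_eq_of_lt h2, Nat.mod_eq_of_lt h3] at h1; omega
  · have : (j : ℕ) + 1 = t := by omega
    rw [Nat.mod_eq_of_lt h2, this, Nat.mod_self] at h1; omega
  · have : (i : ℕ) + 1 = t := by omega
    rw [Nat.mod_eq_of_lt h3, this, Nat.mod_self] at h1; omega
  · omega

/-- The clockwise walk away from arrow `i`. -/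
def cwWalk (ε : Fin t → Bool) (i : Fin t) : Walk ε where
  u p := ⟨(i + 1 + p) % t, Nat.mod_lt _ i.pos⟩
  e p := ⟨(i + 1 + p) % t, Nat.mod_lt _ i.pos⟩
  b p := ε ⟨(i + 1 + p) % t, Nat.mod_lt _ i.pos⟩
  ht := i.pos
  hb p h := by
    simp only [src, tgt, h, next, Fin.mk.injEq, if_true, true_and]
    rw [Nat.mod_add_mod]; rfl
  hb' p h := by
    simp only [src, tgt, h, next, Fin.mk.injEq]
    refine ⟨?_, rfl⟩
    simp only [Bool.false_eq_true, if_false, Fin.mk.injEq]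
    rw [Nat.mod_add_mod]; rfl
  pu p := by simp [← add_assoc]
  pe p := by simp [← add_assoc]
  pb p := by simp [← add_assoc]

lemma cw_e (i : Fin t) : (cwWalk ε i).e (t - 1) = i := by
  apply Fin.ext
  have h := i.2
  simp only [cwWalk]
  rw [show (i : ℕ) + 1 + (t - 1) = i + t by omega, Nat.add_mod_right, Nat.mod_eq_of_lt h]

/-- The counterclockwise walk away from arrow `i`. -/
def ccwWalk (ε : Fin t → Bool) (i : Fin t) : Walk ε where
  u p := ⟨(i + (t - 1) * p) % t, Nat.mod_lt _ i.pos⟩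
  e p := ⟨(i + (t - 1) * (p + 1)) % t, Nat.mod_lt _ i.pos⟩
  b p := ! ε ⟨(i + (t - 1) * (p + 1)) % t, Nat.mod_lt _ i.pos⟩
  ht := i.pos
  hb p h := by
    have hi := i.2
    simp only [Bool.not_eq_true'] at h
    simp only [src, tgt, h, next]
    refine ⟨?_, rfl⟩
    simp only [Bool.false_eq_true, if_false, Fin.mk.injEq]
    rw [Nat.mod_add_mod, show (i : ℕ) + (t - 1) * (p + 1) + 1 = i + (t - 1) * p + t by
      rw [Nat.mul_succ]; omega, Nat.add_mod_right]
  hb' p h := by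
    have hi := i.2
    simp only [Bool.not_eq_false'] at h
    simp only [src, tgt, h, next]
    refine ⟨rfl, ?_⟩
    simp only [if_true, Fin.mk.injEq]
    rw [Nat.mod_add_mod, show (i : ℕ) + (t - 1) * (p + 1) + 1 = i + (t - 1) * p + t by
      rw [Nat.mul_succ]; omega, Nat.add_mod_right]
  pu p := by
    apply Fin.ext
    change (i + (t - 1) * (p + t)) % t = (i + (t - 1) * p) % t
    rw [Nat.mul_add, ← add_assoc, Nat.add_mul_mod_self_right]
  pe p := by
    apply Fin.ext
    change (i + (t - 1) * (p + t + 1)) % t = (i + (t - 1) * (p + 1)) % t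
    rw [show p + t + 1 = p + 1 + t by omega, Nat.mul_add _ (p + 1), ← add_assoc,
      Nat.add_mul_mod_self_right]
  pb p := by
    congr 2
    apply Fin.ext
    change (i + (t - 1) * (p + t + 1)) % t = (i + (t - 1) * (p + 1)) % t
    rw [show p + t + 1 = p + 1 + t by omega, Nat.mul_add _ (p + 1), ← add_assoc,
      Nat.add_mul_mod_self_right]

lemma ccw_e (i : Fin t) : (ccwWalk ε i).e (t - 1) = i := by
  apply Fin.ext
  have h := i.2
  change (i + (t - 1) * (t - 1 + 1)) % t = i
  rw [show t - 1 + 1 = t by omega, Nat.add_mul_mod_self_right, Nat.mod_eq_of_lt h]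

lemma sd_of_cw (X : Rep t ε) (i : Fin t) {n y g} (h : WStr (cwWalk ε i) X n y g) :
    SD X (i + 1) n y g := by
  have hb : ∀ p, (cwWalk ε i).b p = ε ((cwWalk ε i).e p) := fun p => rfl
  have hu : ∀ p, (((cwWalk ε i).u p : Fin t) : ℕ) = (i + 1 + p) % t := fun p => rfl
  have hue : ∀ p, (cwWalk ε i).e p = (cwWalk ε i).u p := fun p => rfl
  have hi := cw_e (ε := ε) i
  have hnext : ∀ p, next ((cwWalk ε i).e p) = (cwWalk ε i).u (p + 1) := by
    intro p; apply Fin.ext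
    simp only [next, hue, hu]
    rw [Nat.mod_add_mod]; rfl
  have hi0 : next i = (cwWalk ε i).u 0 := rfl
  generalize cwWalk ε i = w at *
  have hbi := hb (t - 1)
  rw [hi] at hbi
  have E : ∀ p (k : Fin t), (k : ℕ) = (i + 1 + p) % t → k = w.e p := fun p k hk =>
    Fin.ext (by rw [hk, hue, hu])
  have F : ∀ p (k : Fin t), (next k : ℕ) = (i + 1 + (p + 1)) % t → k = w.e p := fun p k hk =>
    next_inj (Fin.ext (by rw [hk, hnext, hu]))
  have F0 : ∀ (k : Fin t), (next k : ℕ) = (i + 1 + 0) % t → k = i := fun k hk =>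
    next_inj (Fin.ext (by rw [hk, hi0, hu]))
  obtain ⟨s1, s2, l1, l2, l3, l4, e1, e2, nz⟩ := h
  rw [hi] at s1 s2
  constructor
  · intro p hp k hk hε
    obtain rfl := E p k hk
    rcases hp.lt_or_eq with h | rfl
    · rw [if_pos h]; exact l1 p h (by rw [hb, hε])
    · rw [if_neg (lt_irrefl _)]; exact e1 (by rw [hb, hε])
  · intro p hp k hk hε
    rcases p with _ | p
    · obtain rfl := F0 k hk
      exact s1 (by rw [hbi, hε])
    · obtain rfl := F p k hk
      exact l2 p (by omega) (by rw [hb, hε])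
  · intro p hp k hk hε
    rcases p with _ | p
    · obtain rfl := F0 k hk
      exact s2 (by rw [hbi, hε])
    · obtain rfl := F p k hk
      exact l3 p (by omega) (by rw [hb, hε])
  · intro p hp k hk hε
    obtain rfl := E p k hk
    rcases hp.lt_or_eq with h | rfl
    · rw [if_pos h]; exact l4 p h (by rw [hb, hε])
    · rw [if_neg (lt_irrefl _)]; exact e2 (by rw [hb, hε])
  · intro p hp v hv
    obtain rfl : v = w.u p := Fin.ext (by rw [hv, hu])
    exact nz p hp

lemma sd_of_ccw (X : Rep t ε) (i : Fin t) {n y g} (h : WStr (ccwWalk ε i) X n y g) :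
    SD X (i + (t - 1) * n) n (fun p => y (n - p)) (fun p => g (n - p)) := by
  have hb : ∀ p, (ccwWalk ε i).b p = ! ε ((ccwWalk ε i).e p) := fun p => rfl
  have hu : ∀ p, (((ccwWalk ε i).u p : Fin t) : ℕ) = (i + (t - 1) * p) % t := fun p => rfl
  have hue : ∀ p, (ccwWalk ε i).e p = (ccwWalk ε i).u (p + 1) := fun p => rfl
  have hi := ccw_e (ε := ε) i
  have ht := i.pos
  have hnext : ∀ p, next ((ccwWalk ε i).e p) = (ccwWalk ε i).u p := by
    intro p; apply Fin.ext
    simp only [next, hue, hu]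
    rw [Nat.mod_add_mod, show (i : ℕ) + (t - 1) * (p + 1) + 1 = i + (t - 1) * p + t by
      rw [Nat.mul_succ]; omega, Nat.add_mod_right]
  have hi0 : i = (ccwWalk ε i).u 0 := by
    apply Fin.ext; rw [hu, Nat.mul_zero, Nat.add_zero, Nat.mod_eq_of_lt i.2]
  generalize ccwWalk ε i = w at *
  have hbi := hb (t - 1)
  rw [hi] at hbi
  have idx : ∀ p ≤ n, (i + (t - 1) * n + p) % t = (w.u (n - p) : ℕ) := by
    intro p hp
    obtain ⟨m, rfl⟩ : ∃ m, n = m + p := ⟨n - p, by omega⟩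
    obtain ⟨τ, rfl⟩ : ∃ τ, t = τ + 1 := ⟨t - 1, by omega⟩
    rw [hu, Nat.add_sub_cancel, Nat.add_sub_cancel,
      show (i : ℕ) + τ * (m + p) + p = i + τ * m + (τ + 1) * p by ring, Nat.add_mul_mod_self_left]
  have E : ∀ p ≤ n, ∀ (k : Fin t), (k : ℕ) = (i + (t - 1) * n + p) % t → k = w.u (n - p) :=
    fun p hp k hk => Fin.ext (by rw [hk, idx p hp])
  have F : ∀ p ≤ n, ∀ (k : Fin t), (next k : ℕ) = (i + (t - 1) * n + p) % t → k = w.e (n - p) :=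
    fun p hp k hk => next_inj (Fin.ext (by rw [hk, hnext, idx p hp]))
  obtain ⟨s1, s2, l1, l2, l3, l4, e1, e2, nz⟩ := h
  rw [hi] at s1 s2
  constructor
  · intro p hp k hk hε
    have hk := E p hp k hk
    rcases hp.lt_or_eq with h | rfl
    · obtain ⟨q, rfl⟩ : ∃ q, n = p + (q + 1) := ⟨n - p - 1, by omega⟩
      rw [if_pos h]
      beta_reduce
      rw [show p + (q + 1) - p = q + 1 by omega] at hk ⊢
      rw [show p + (q + 1) - (p + 1) = q by omega]
      rw [← hue] at hk
      subst hk
      exact l2 q (by omega) (by rw [hb, hε]; rfl)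
    · rw [if_neg (lt_irrefl _)]
      beta_reduce
      rw [Nat.sub_self] at hk ⊢
      rw [← hi0] at hk; subst hk
      exact s1 (by rw [hbi, hε]; rfl)
  · intro p hp k hk hε
    have hk := F p hp k hk
    beta_reduce
    rcases p with _ | p
    · rw [if_pos rfl]; rw [Nat.sub_zero] at hk ⊢
      subst hk
      exact e1 (by rw [hb, hε]; rfl)
    · rw [if_neg (by omega), show n - (p + 1 - 1) = n - (p + 1) + 1 by omega]
      subst hk
      exact l1 _ (by omega) (by rw [hb, hε]; rfl)
  · intro p hp k hk hε
    have hk := F p hp k hk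
    beta_reduce
    rcases p with _ | p
    · rw [if_pos rfl]; rw [Nat.sub_zero] at hk ⊢
      subst hk
      exact e2 (by rw [hb, hε]; rfl)
    · rw [if_neg (by omega), show n - (p + 1 - 1) = n - (p + 1) + 1 by omega]
      subst hk
      exact l4 _ (by omega) (by rw [hb, hε]; rfl)
  · intro p hp k hk hε
    have hk := E p hp k hk
    rcases hp.lt_or_eq with h | rfl
    · obtain ⟨q, rfl⟩ : ∃ q, n = p + (q + 1) := ⟨n - p - 1, by omega⟩
      rw [if_pos h]
      beta_reduce
      rw [show p + (q + 1) - p = q + 1 by omega] at hk ⊢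
      rw [show p + (q + 1) - (p + 1) = q by omega]
      rw [← hue] at hk
      subst hk
      exact l3 q (by omega) (by rw [hb, hε]; rfl)
    · rw [if_neg (lt_irrefl _)]
      beta_reduce
      rw [Nat.sub_self] at hk ⊢
      rw [← hi0] at hk; subst hk
      exact s2 (by rw [hbi, hε]; rfl)
  · intro p hp v hv
    obtain rfl : v = w.u (n - p) := E p hp v hv
    exact nz _ (by omega)

lemma SD.mod {X : Rep t ε} {a n y g} (h : SD X a n y g) : SD X (a % t) n y g := by
  obtain ⟨r1, r2, r3, r4, nz⟩ := h
  constructor <;> simpa only [Nat.mod_add_mod]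

lemma not_bij_cases {a b : ℕ} {M : Matrix (Fin a) (Fin b) ℂ} (h : ¬ Bij M) :
    (∃ x, x ≠ 0 ∧ M *ᵥ x = 0) ∨ (∃ z, ∀ x, M *ᵥ x ≠ z) := by
  by_contra hcon
  push Not at hcon
  obtain ⟨h1, h2⟩ := hcon
  apply h
  have hinj : Function.Injective M.mulVecLin := by
    rw [← LinearMap.ker_eq_bot, LinearMap.ker_eq_bot']
    intro x hx
    by_contra hx0
    exact h1 x hx0 hx
  let e := LinearEquiv.ofBijective M.mulVecLin ⟨hinj, fun z => h2 z⟩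
  have he : LinearMap.toMatrix' (e : (Fin b → ℂ) →ₗ[ℂ] (Fin a → ℂ)) = M :=
    LinearMap.toMatrix'_toLin' M
  refine ⟨LinearMap.toMatrix' (e.symm : (Fin a → ℂ) →ₗ[ℂ] (Fin b → ℂ)), ?_, ?_⟩
  · conv_lhs => rw [← he]
    rw [← LinearMap.toMatrix'_comp]; simp
  · conv_lhs => rw [← he]
    rw [← LinearMap.toMatrix'_comp]; simp

lemma exists_sd (X : Rep t ε) (i : Fin t) (h : ¬ Bij (X.A i)) :
    ∃ a n y g, a < t ∧ SD X a n y g := by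
  have hb : (cwWalk ε i).b (t - 1) = ε ((cwWalk ε i).e (t - 1)) := rfl
  have hb' : (ccwWalk ε i).b (t - 1) = ! ε ((ccwWalk ε i).e (t - 1)) := rfl
  have h1 := exists_wstr (cwWalk ε i) X
  have h2 := exists_wstr (ccwWalk ε i) X
  rw [hb, cw_e] at h1
  rw [hb', ccw_e] at h2
  suffices hh : ∃ a n y g, SD X a n y g by
    obtain ⟨a, n, y, g, hh⟩ := hh
    exact ⟨a % t, n, y, g, Nat.mod_lt _ i.pos, hh.mod⟩
  cases hε : ε i
  · rcases not_bij_cases h with hc | hc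
    · obtain ⟨n, y, g, hh⟩ := h1 (Or.inl ⟨hε, hc⟩)
      exact ⟨_, _, _, _, sd_of_cw X i hh⟩
    · obtain ⟨n, y, g, hh⟩ := h2 (Or.inr ⟨by rw [hε]; rfl, hc⟩)
      exact ⟨_, _, _, _, sd_of_ccw X i hh⟩
  · rcases not_bij_cases h with hc | hc
    · obtain ⟨n, y, g, hh⟩ := h2 (Or.inl ⟨by rw [hε]; rfl, hc⟩)
      exact ⟨_, _, _, _, sd_of_ccw X i hh⟩
    · obtain ⟨n, y, g, hh⟩ := h1 (Or.inr ⟨hε, hc⟩)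
      exact ⟨_, _, _, _, sd_of_cw X i hh⟩

end StringData

section StringRep
open CategoryTheory

/-- Enumeration of the positions `0..n` of a string starting at `a` by vertex. -/
structure PosData (t a n : ℕ) (dd : Fin t → ℕ) (pos : Fin t → ℕ → ℕ) : Prop where
  le : ∀ v s, s < dd v → pos v s ≤ n
  md : ∀ v s, s < dd v → (a + pos v s) % t = v
  inj : ∀ v s s', s < dd v → s' < dd v → pos v s = pos v s' → s = s'
  surj : ∀ (v : Fin t) (m : ℕ), m ≤ n → (a + m) % t = (v : ℕ) → ∃ s, s < dd v ∧ pos v s = m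

/-- The string representation. -/
def strRep (ε : Fin t → Bool) (dd : Fin t → ℕ) (pos : Fin t → ℕ → ℕ) : Rep t ε where
  d := dd
  A i := fun r s =>
    if (if ε i then pos (tgt ε i) r = pos (src ε i) s + 1
      else pos (src ε i) s = pos (tgt ε i) r + 1) then 1 else 0

lemma PosData.sum {a n : ℕ} {dd : Fin t → ℕ} {pos : Fin t → ℕ → ℕ} (P : PosData t a n dd pos)
    (v : Fin t) (m : ℕ) (hm : m ≤ n → (a + m) % t = (v : ℕ)) (F : ℕ → ℂ) :
    ∑ s : Fin (dd v), F (pos v s) * (if pos v s = m then 1 else 0) =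
      if m ≤ n then F m else 0 := by
  split_ifs with h
  · obtain ⟨s, hs, e⟩ := P.surj v m h (hm h)
    rw [Finset.sum_eq_single ⟨s, hs⟩]
    · simp [e]
    · intro b _ hb
      rw [if_neg, mul_zero]
      intro e'
      exact hb (Fin.ext (P.inj v b s b.2 hs (e'.trans e.symm)))
    · simp
  · apply Finset.sum_eq_zero
    intro s _
    rw [if_neg, mul_zero]
    intro e
    exact h (e ▸ P.le v s s.2)

lemma mod_succ_aux {a p : ℕ} {i : Fin t} (h : (a + p) % t = i) : (a + (p + 1)) % t = next i := by
  simp only [next]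
  rw [← add_assoc, ← Nat.mod_add_mod, h]

lemma mod_pred_aux {a p : ℕ} {i : Fin t} (h : (a + (p + 1)) % t = next i) : (a + p) % t = i := by
  have h1 : next (⟨(a + p) % t, Nat.mod_lt _ i.pos⟩ : Fin t) = next i := by
    apply Fin.ext
    rw [← h]
    simp only [next]
    rw [Nat.mod_add_mod, add_assoc]
  exact congrArg Fin.val (next_inj h1)

lemma str_homs {X : Rep t ε} {a n : ℕ} {y g} (H : SD X a n y g) {dd : Fin t → ℕ}
    {pos : Fin t → ℕ → ℕ} (P : PosData t a n dd pos) :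
    ∃ (psi : strRep ε dd pos ⟶ X) (phi : X ⟶ strRep ε dd pos),
      ∀ v (s : Fin (dd v)), cm (psi ≫ phi) v s s ≠ 0 := by
  refine ⟨mkHom (fun v k s => y (pos v s) v k) ?_,
    mkHom (fun v s k => g (pos v s) v (Pi.single k 1)) ?_, ?_⟩
  · intro i
    ext k s
    have hsl := P.le _ _ s.2
    have hsm := P.md _ _ s.2
    have hR : (X.A i * Matrix.of (fun k (s : Fin (dd (src ε i))) => y (pos (src ε i) s) (src ε i) k)) k s =
        (X.A i *ᵥ y (pos (src ε i) s) (src ε i)) k := rfl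
    refine (Matrix.mul_apply).trans (Eq.trans ?_ hR.symm)
    cases hε : ε i
    · have h1 : (src ε i : ℕ) = next i := by simp [src, hε]
      have h2 : (tgt ε i : ℕ) = i := by simp [tgt, hε]
      rw [H.r2 _ hsl i (by rw [hsm, h1]) hε]
      rcases Nat.eq_zero_or_pos (pos (src ε i) s) with h0 | h0
      · rw [if_pos h0]
        refine Finset.sum_eq_zero (M := ℂ) ?_
        intro r _
        simp [strRep, hε, h0]
      · rw [if_neg (by omega)]
        have hp : pos (src ε i) s = (pos (src ε i) s - 1) + 1 := by omega
        have := P.sum (tgt ε i) (pos (src ε i) s - 1)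
          (fun _ => by rw [h2]; apply mod_pred_aux; rw [← hp, hsm, h1])
          (fun p => y p (tgt ε i) k)
        rw [if_pos (by omega)] at this
        rw [← this]
        apply Finset.sum_congr rfl
        intro r _
        congr 1
        simp only [strRep, hε]
        apply if_congr _ rfl rfl
        simp only [Bool.false_eq_true, if_false]
        omega
    · have h1 : (src ε i : ℕ) = i := by simp [src, hε]
      have h2 : (tgt ε i : ℕ) = next i := by simp [tgt, hε]
      rw [H.r1 _ hsl i (by rw [hsm, h1]) hε]
      have := P.sum (tgt ε i) (pos (src ε i) s + 1)
        (fun _ => by rw [h2]; apply mod_succ_aux; rw [hsm, h1])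
        (fun p => y p (tgt ε i) k)
      refine Eq.trans ?_ (this.trans ?_)
      · apply Finset.sum_congr rfl
        intro r _
        congr 1
        simp only [strRep, hε]
        apply if_congr _ rfl rfl
        simp only [if_true]
      · simp only [Nat.succ_le_iff]
        split_ifs <;> rfl
  · intro i
    ext r k
    have hsl := P.le _ _ r.2
    have hsm := P.md _ _ r.2
    have hL : ∀ r : Fin (dd (tgt ε i)), (Matrix.of (fun (s : Fin (dd (tgt ε i))) k =>
        g (pos (tgt ε i) s) (tgt ε i) (Pi.single k 1)) * X.A i) r k =
        (g (pos (tgt ε i) r) (tgt ε i) ∘ₗ (X.A i).mulVecLin) (Pi.single k 1) := by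
      intro r
      rw [LinearMap.comp_apply, Matrix.mulVecLin_apply, Matrix.mul_apply]
      conv_rhs => rw [pi_eq_sum_univ' (X.A i *ᵥ Pi.single k 1)]
      rw [map_sum]
      apply Finset.sum_congr rfl
      intro j _
      rw [map_smul]
      simp only [smul_eq_mul, mul_comm, Matrix.mulVec_single_one, Matrix.col_apply]
      congr 2
    refine Eq.trans (hL r) (Eq.trans ?_ (Matrix.mul_apply).symm)
    cases hε : ε i
    · have h1 : (src ε i : ℕ) = next i := by simp [src, hε]
      have h2 : (tgt ε i : ℕ) = i := by simp [tgt, hε]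
      rw [H.r4 _ hsl i (by rw [hsm, h2]) hε]
      have := P.sum (src ε i) (pos (tgt ε i) r + 1)
        (fun _ => by rw [h1]; apply mod_succ_aux; rw [hsm, h2])
        (fun p => g p (src ε i) (Pi.single k 1))
      refine Eq.trans ?_ (this.symm.trans ?_)
      · simp only [Nat.succ_le_iff]
        split_ifs <;> rfl
      · apply Finset.sum_congr rfl
        intro s _
        rw [mul_comm]
        congr 1
        simp only [strRep, hε]
        apply if_congr _ rfl rfl
        simp
    · have h1 : (src ε i : ℕ) = i := by simp [src, hε]
      have h2 : (tgt ε i : ℕ) = next i := by simp [tgt, hε]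
      rw [H.r3 _ hsl i (by rw [hsm, h2]) hε]
      rcases Nat.eq_zero_or_pos (pos (tgt ε i) r) with h0 | h0
      · rw [if_pos h0]
        symm
        refine Finset.sum_eq_zero (M := ℂ) ?_
        intro s _
        simp [strRep, hε, h0]
      · rw [if_neg (by omega)]
        have hp : pos (tgt ε i) r = (pos (tgt ε i) r - 1) + 1 := by omega
        have := P.sum (src ε i) (pos (tgt ε i) r - 1)
          (fun _ => by rw [h1]; apply mod_pred_aux; rw [← hp, hsm, h2])
          (fun p => g p (src ε i) (Pi.single k 1))
        rw [if_pos (by omega)] at this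
        rw [← this]
        apply Finset.sum_congr rfl
        intro s _
        rw [mul_comm]
        congr 1
        simp only [strRep, hε]
        apply if_congr _ rfl rfl
        simp only [if_true]
        omega
  · intro v s
    change (∑ k, g (pos v s) v (Pi.single k 1) * y (pos v s) v k) ≠ 0
    have hsl := P.le _ _ s.2
    have hsm := P.md _ _ s.2
    have hn := H.nz _ hsl v hsm.symm
    convert hn using 1
    conv_rhs => rw [pi_eq_sum_univ' (y (pos v s) v)]
    rw [map_sum]
    apply Finset.sum_congr rfl
    intro j _
    rw [map_smul, smul_eq_mul, mul_comm]

end StringRep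

section Concrete
open CategoryTheory

/-- Offset of vertex `v` from the start `a`. -/
def off (a : ℕ) (v : Fin t) : ℕ := if a ≤ (v : ℕ) then v - a else v + t - a

/-- Dimensions of the string representation. -/
def sdim (a n : ℕ) (v : Fin t) : ℕ :=
  if off a v < (n + 1) % t then (n + 1) / t + 1 else (n + 1) / t

/-- Index, possibly reversed. -/
def uu (rev : Bool) (D s : ℕ) : ℕ := if rev then D - 1 - s else s

/-- Positions at a vertex. -/
def spos (rev : Bool) (a n : ℕ) (v : Fin t) (s : ℕ) : ℕ := off a v + t * uu rev (sdim a n v) s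

lemma off_lt {a : ℕ} (ha : a < t) (v : Fin t) : off a v < t := by
  have := v.2
  unfold off; split_ifs <;> omega

lemma off_mod {a : ℕ} (ha : a < t) (v : Fin t) : (a + off a v) % t = v := by
  have hv := v.2
  unfold off; split_ifs with h
  · rw [show a + ((v : ℕ) - a) = v by omega, Nat.mod_eq_of_lt hv]
  · rw [show a + ((v : ℕ) + t - a) = v + t by omega, Nat.add_mod_right, Nat.mod_eq_of_lt hv]

lemma off_of_mod {a m : ℕ} (ha : a < t) (v : Fin t) (h : (a + m) % t = v) : m % t = off a v := by
  have h1 : (a + m) ≡ (a + off a v) [MOD t] := by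
    rw [Nat.ModEq, off_mod ha, h]
  have h2 := Nat.ModEq.add_left_cancel' a h1
  rw [Nat.ModEq, Nat.mod_eq_of_lt (off_lt ha v)] at h2
  exact h2

lemma off_next {a : ℕ} (ha : a < t) (i : Fin t) :
    off a (next i) = if off a i = t - 1 then 0 else off a i + 1 := by
  have hi := i.2
  have hn : (next i : ℕ) = if (i : ℕ) = t - 1 then 0 else (i : ℕ) + 1 := by
    simp only [next]
    split_ifs with h
    · rw [h, show t - 1 + 1 = t by omega, Nat.mod_self]
    · exact Nat.mod_eq_of_lt (by omega)
  unfold off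
  rw [hn]
  split_ifs <;> omega

lemma lt_sdim {a n : ℕ} (ha : a < t) (v : Fin t) (u : ℕ) :
    u < sdim a n v ↔ off a v + t * u ≤ n := by
  have h1 := Nat.div_add_mod (n + 1) t
  have h2 := Nat.mod_lt (n + 1) (show 0 < t by omega)
  have h3 := off_lt ha v
  unfold sdim
  set q := (n + 1) / t
  set r := (n + 1) % t
  rcases lt_trichotomy u q with h | h | h
  · have : t * (u + 1) ≤ t * q := Nat.mul_le_mul_left _ h
    rw [mul_add] at this
    constructor
    · intro _; omega
    · intro _; split_ifs <;> omega
  · subst h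
    split_ifs <;> omega
  · have : t * (q + 1) ≤ t * u := Nat.mul_le_mul_left _ h
    rw [mul_add] at this
    split_ifs <;> omega

lemma uu_lt {rev : Bool} {D s : ℕ} (h : s < D) : uu rev D s < D := by
  unfold uu; split_ifs <;> omega

lemma uu_uu {rev : Bool} {D s : ℕ} (h : s < D) : uu rev D (uu rev D s) = s := by
  unfold uu; split_ifs <;> omega

lemma sposData {a n : ℕ} (ha : a < t) (rev : Bool) :
    PosData t a n (sdim a n) (spos rev a n) where
  le v s hs := (lt_sdim ha v _).1 (uu_lt hs)
  md v s hs := by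
    rw [spos, ← add_assoc, Nat.add_mul_mod_self_left, off_mod ha]
  inj v s s' hs hs' h := by
    have ht : 0 < t := by omega
    have h1 := Nat.eq_of_mul_eq_mul_left ht (Nat.add_left_cancel h)
    rw [← uu_uu hs (rev := rev), h1, uu_uu hs']
  surj v m hm h := by
    have h1 := off_of_mod ha v h
    have h2 := Nat.mod_add_div m t
    rw [h1] at h2
    have h3 := (lt_sdim (n := n) ha v (m / t)).2 (by rw [h2]; exact hm)
    exact ⟨uu rev (sdim a n v) (m / t), uu_lt h3, by rw [spos, uu_uu h3, h2]⟩

lemma lnk1 {a n : ℕ} (ha : a < t) (rev : Bool) (i : Fin t) (hi : off a i ≠ t - 1) (α β : ℕ) :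
    spos rev a n (next i) β = spos rev a n i α + 1 ↔
      uu rev (sdim a n (next i)) β = uu rev (sdim a n i) α := by
  have ht : 0 < t := by omega
  unfold spos
  rw [off_next ha, if_neg hi]
  constructor
  · intro h
    exact Nat.eq_of_mul_eq_mul_left ht (by omega)
  · intro h
    rw [h]; omega

lemma lnk0 {a n : ℕ} (ha : a < t) (rev : Bool) (i : Fin t) (hi : off a i = t - 1) (α β : ℕ) :
    spos rev a n (next i) β = spos rev a n i α + 1 ↔
      uu rev (sdim a n (next i)) β = uu rev (sdim a n i) α + 1 := by
  have ht : 0 < t := by omega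
  unfold spos
  rw [off_next ha, if_pos hi, hi]
  constructor
  · intro h
    exact Nat.eq_of_mul_eq_mul_left ht (by rw [mul_add]; omega)
  · intro h
    rw [h, mul_add]; omega

lemma entry_true {dd : Fin t → ℕ} {pos : Fin t → ℕ → ℕ} {i : Fin t} {φ : ℕ → ℕ → Prop}
    [∀ a b, Decidable (φ a b)]
    (h : ∀ α β, α < dd i → β < dd (next i) → (pos (next i) β = pos i α + 1 ↔ φ α β))
    (hε : ε i = true) :
    (strRep ε dd pos).d (src ε i) = dd i ∧ (strRep ε dd pos).d (tgt ε i) = dd (next i) ∧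
    ∀ r s, (strRep ε dd pos).A i r s = if φ s r then 1 else 0 := by
  have h1 : src ε i = i := by simp [src, hε]
  have h2 : tgt ε i = next i := by simp [tgt, hε]
  refine ⟨by simp [strRep, h1], by simp [strRep, h2], fun r s => ?_⟩
  simp only [strRep]
  apply if_congr _ rfl rfl
  have key : ∀ r s, r < dd (tgt ε i) → s < dd (src ε i) →
      ((if ε i then pos (tgt ε i) r = pos (src ε i) s + 1
        else pos (src ε i) s = pos (tgt ε i) r + 1) ↔ φ s r) := by
    intro r s
    rw [h1, h2, if_pos hε]
    exact fun hr hs => h s r hs hr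
  exact key r s r.2 s.2

lemma entry_false {dd : Fin t → ℕ} {pos : Fin t → ℕ → ℕ} {i : Fin t} {φ : ℕ → ℕ → Prop}
    [∀ a b, Decidable (φ a b)]
    (h : ∀ α β, α < dd i → β < dd (next i) → (pos (next i) β = pos i α + 1 ↔ φ α β))
    (hε : ε i = false) :
    (strRep ε dd pos).d (src ε i) = dd (next i) ∧ (strRep ε dd pos).d (tgt ε i) = dd i ∧
    ∀ r s, (strRep ε dd pos).A i r s = if φ r s then 1 else 0 := by
  have h1 : src ε i = next i := by simp [src, hε]
  have h2 : tgt ε i = i := by simp [tgt, hε]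
  refine ⟨by simp [strRep, h1], by simp [strRep, h2], fun r s => ?_⟩
  simp only [strRep]
  apply if_congr _ rfl rfl
  have key : ∀ r s, r < dd (tgt ε i) → s < dd (src ε i) →
      ((if ε i then pos (tgt ε i) r = pos (src ε i) s + 1
        else pos (src ε i) s = pos (tgt ε i) r + 1) ↔ φ r s) := by
    intro r s
    rw [h1, h2, if_neg (by simp [hε])]
    exact fun hr hs => h r s hr hs
  exact key r s r.2 s.2

lemma entry_id {dd : Fin t → ℕ} {pos : Fin t → ℕ → ℕ} {i : Fin t}
    (h : ∀ α β, α < dd i → β < dd (next i) → (pos (next i) β = pos i α + 1 ↔ β = α)) :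
    EntryId ((strRep ε dd pos).A i) := by
  intro r s
  cases hε : ε i
  · rw [(entry_false h hε).2.2 r s]
    exact if_congr eq_comm rfl rfl
  · exact (entry_true h hε).2.2 r s

lemma str_canonII {a n : ℕ} (ha : a < t) (hr : (n + 1) % t = 0) :
    ∃ rev, Canonical (strRep ε (sdim a n) (spos rev a n)) ∧ 
      ∃ v, ∃ s : Fin (sdim a n v), LocAt (strRep ε (sdim a n) (spos rev a n)) v s := by
  have hd : ∀ v : Fin t, sdim a n v = (n + 1) / t := by
    intro v; simp [sdim, hr]
  have hq : 1 ≤ (n + 1) / t := by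
    by_contra hq
    have h1 := Nat.div_add_mod (n + 1) t
    rw [hr, Nat.eq_zero_of_not_pos hq] at h1
    omega
  obtain ⟨m0, hm0⟩ : ∃ m0 : Fin t, (m0 : ℕ) = if a = 0 then t - 1 else a - 1 :=
    ⟨⟨if a = 0 then t - 1 else a - 1, by split_ifs <;> omega⟩, rfl⟩
  have ho : ∀ v : Fin t, off a v = t - 1 ↔ v = m0 := by
    intro v
    rw [Fin.ext_iff, hm0]
    have := v.2
    unfold off
    split_ifs <;> omega
  have hId : ∀ k, k ≠ m0 → EntryId ((strRep ε (sdim a n) (spos (ε m0) a n)).A k) := by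
    intro k hk
    apply entry_id
    intro α β hα hβ
    rw [lnk1 ha _ _ (by rwa [Ne, ho])]
    simp only [hd] at hα hβ ⊢
    unfold uu
    split_ifs <;> omega
  have hJ : EntryJ ((n + 1) / t) 0 ((strRep ε (sdim a n) (spos (ε m0) a n)).A m0) := by
    refine ⟨hd _, hd _, ?_⟩
    intro r s
    have key : ∀ c d : ℕ, (if c = d then (0 : ℂ) else if c = d + 1 then 1 else 0) =
        if c = d + 1 then 1 else 0 := by
      intro c d; split_ifs <;> first | rfl | omega
    rw [key]
    cases hε : ε m0
    · have h : ∀ α β, α < sdim a n m0 → β < sdim a n (next m0) →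
          (spos false a n (next m0) β = spos false a n m0 α + 1 ↔ β = α + 1) := by
        intro α β hα hβ
        rw [lnk0 ha _ _ ((ho _).2 rfl)]
        simp [uu]
      exact (entry_false h hε).2.2 r s
    · have h : ∀ α β, α < sdim a n m0 → β < sdim a n (next m0) →
          (spos true a n (next m0) β = spos true a n m0 α + 1 ↔ α = β + 1) := by
        intro α β hα hβ
        rw [lnk0 ha _ _ ((ho _).2 rfl)]
        simp only [hd] at hα hβ ⊢
        simp only [uu, if_true]
        omega
      exact (entry_true h hε).2.2 r s
  refine ⟨ε m0, Or.inr (Or.inl ⟨m0, (n + 1) / t, hq, hd, hId, hJ⟩), m0, ⟨0, ?_⟩, ?_⟩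
  · rw [hd]; omega
  · exact locJ hd hId hJ _ _ rfl

lemma str_canonIII {a n : ℕ} (ha : a < t) (hr : (n + 1) % t ≠ 0) :
    ∃ rev, CanonicalIII (strRep ε (sdim a n) (spos rev a n)) := by
  have hrt := Nat.mod_lt (n + 1) (show 0 < t by omega)
  obtain ⟨r, hr'⟩ : ∃ r, r = (n + 1) % t := ⟨_, rfl⟩
  obtain ⟨q, hq'⟩ : ∃ q, q = (n + 1) / t := ⟨_, rfl⟩
  have hd : ∀ v : Fin t, sdim a n v = if off a v < r then q + 1 else q := by
    intro v; rw [sdim, hr', hq']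
  rw [← hr'] at hr hrt
  obtain ⟨m0, hm0⟩ : ∃ m0 : Fin t, (m0 : ℕ) = if a = 0 then t - 1 else a - 1 :=
    ⟨⟨if a = 0 then t - 1 else a - 1, by split_ifs <;> omega⟩, rfl⟩
  obtain ⟨m1, hm1⟩ : ∃ m1 : Fin t, (m1 : ℕ) = if a + r - 1 < t then a + r - 1 else a + r - 1 - t :=
    ⟨⟨if a + r - 1 < t then a + r - 1 else a + r - 1 - t, by split_ifs <;> omega⟩, rfl⟩
  have ho : ∀ v : Fin t, off a v = t - 1 ↔ v = m0 := by
    intro v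
    rw [Fin.ext_iff, hm0]
    have := v.2
    unfold off
    split_ifs <;> omega
  have ho1 : ∀ v : Fin t, off a v = r - 1 ↔ v = m1 := by
    intro v
    rw [Fin.ext_iff, hm1]
    have := v.2
    unfold off
    split_ifs <;> omega
  have hne : (m0 : ℕ) ≠ m1 := by
    rw [hm0, hm1]; split_ifs <;> omega
  have hd0 : sdim a n m0 = q := by
    rw [hd, (ho _).2 rfl, if_neg (by omega)]
  have hd0' : sdim a n (next m0) = q + 1 := by
    rw [hd, off_next ha, if_pos ((ho _).2 rfl), if_pos (by omega)]
  have hd1 : sdim a n m1 = q + 1 := by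
    rw [hd, (ho1 _).2 rfl, if_pos (by omega)]
  have hd1' : sdim a n (next m1) = q := by
    rw [hd, off_next ha, (ho1 _).2 rfl, if_neg (show r - 1 ≠ t - 1 by omega),
      if_neg (show ¬ r - 1 + 1 < r by omega)]
  have hm1o : off a m1 ≠ t - 1 := by rw [(ho1 _).2 rfl]; omega
  have hId : ∀ rev k, k ≠ m0 → k ≠ m1 → EntryId ((strRep ε (sdim a n) (spos rev a n)).A k) := by
    intro rev k hk hk1
    apply entry_id
    intro α β hα hβ
    have e0 : off a k ≠ t - 1 := by rwa [Ne, ho]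
    have e1 : off a k ≠ r - 1 := by rwa [Ne, ho1]
    rw [lnk1 ha _ _ e0]
    have e : sdim a n (next k) = sdim a n k := by
      rw [hd, hd, off_next ha, if_neg e0]
      split_ifs <;> omega
    rw [e] at hβ ⊢
    unfold uu
    split_ifs <;> omega
  have hlow := fun v : Fin t => v.2
  rcases lt_or_gt_of_ne hne with hlt | hlt
  · refine ⟨true, m0, m1, q + 1, hlt, by omega, hId true, Or.inl ⟨?_, ?_⟩, ?_⟩
    · rintro v ⟨h1, h2⟩
      rw [Fin.lt_def] at h1
      rw [Fin.le_def] at h2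
      have : off a v < r := by unfold off; split_ifs at * <;> omega
      exact (hd v).trans (if_pos this)
    · intro v h1
      rw [InArc, Fin.lt_def, Fin.le_def] at h1
      have hv := v.2
      have : ¬ off a v < r := by unfold off; split_ifs at * <;> omega
      exact (hd v).trans (if_neg this)
    · have h0 : ∀ α β, α < sdim a n m0 → β < sdim a n (next m0) →
          (spos true a n (next m0) β = spos true a n m0 α + 1 ↔ β = α) := by
        intro α β hα hβ
        rw [lnk0 ha _ _ ((ho _).2 rfl)]
        simp only [hd0, hd0'] at hα hβ ⊢
        simp only [uu, if_true]
        omega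
      have h1 : ∀ α β, α < sdim a n m1 → β < sdim a n (next m1) →
          (spos true a n (next m1) β = spos true a n m1 α + 1 ↔ α = β + 1) := by
        intro α β hα hβ
        rw [lnk1 ha _ _ hm1o]
        simp only [hd1, hd1'] at hα hβ ⊢
        simp only [uu, if_true]
        omega
      have F0 : ε m0 = true → EntryFT (q + 1) ((strRep ε (sdim a n) (spos true a n)).A m0) := by
        intro hε
        obtain ⟨e1, e2, e3⟩ := entry_true h0 hε
        exact ⟨e2.trans hd0', e1.trans hd0, e3⟩
      have F1 : ε m0 = false → EntryF (q + 1) ((strRep ε (sdim a n) (spos true a n)).A m0) := by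
        intro hε
        obtain ⟨e1, e2, e3⟩ := entry_false h0 hε
        exact ⟨e2.trans hd0, e1.trans hd0', e3⟩
      have G0 : ε m1 = true → EntryG (q + 1) ((strRep ε (sdim a n) (spos true a n)).A m1) := by
        intro hε
        obtain ⟨e1, e2, e3⟩ := entry_true h1 hε
        exact ⟨e2.trans hd1', e1.trans hd1, e3⟩
      have G1 : ε m1 = false → EntryGT (q + 1) ((strRep ε (sdim a n) (spos true a n)).A m1) := by
        intro hε
        obtain ⟨e1, e2, e3⟩ := entry_false h1 hε
        exact ⟨e2.trans hd1, e1.trans hd1', e3⟩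
      cases e0 : ε m0 <;> cases e1 : ε m1
      · exact Or.inr ⟨rfl, Or.inl ⟨F1 e0, G1 e1⟩⟩
      · exact Or.inl ⟨by simp, Or.inl ⟨F1 e0, G0 e1⟩⟩
      · exact Or.inl ⟨by simp, Or.inr ⟨F0 e0, G1 e1⟩⟩
      · exact Or.inr ⟨rfl, Or.inr ⟨F0 e0, G0 e1⟩⟩
  · refine ⟨false, m1, m0, q + 1, hlt, by omega, fun k h1 h2 => hId false k h2 h1,
      Or.inr ⟨?_, ?_⟩, ?_⟩
    · rintro v ⟨h1, h2⟩
      rw [Fin.lt_def] at h1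
      rw [Fin.le_def] at h2
      have hv := v.2
      have : ¬ off a v < r := by unfold off; split_ifs at * <;> omega
      exact (hd v).trans (if_neg this)
    · intro v h1
      rw [InArc, Fin.lt_def, Fin.le_def] at h1
      have hv := v.2
      have : off a v < r := by unfold off; split_ifs at * <;> omega
      exact (hd v).trans (if_pos this)
    · have h0 : ∀ α β, α < sdim a n m0 → β < sdim a n (next m0) →
          (spos false a n (next m0) β = spos false a n m0 α + 1 ↔ β = α + 1) := by
        intro α β hα hβ
        rw [lnk0 ha _ _ ((ho _).2 rfl)]
        simp [uu]
      have h1 : ∀ α β, α < sdim a n m1 → β < sdim a n (next m1) →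
          (spos false a n (next m1) β = spos false a n m1 α + 1 ↔ α = β) := by
        intro α β hα hβ
        rw [lnk1 ha _ _ hm1o]
        simp [uu, eq_comm]
      have F0 : ε m0 = true → EntryGT (q + 1) ((strRep ε (sdim a n) (spos false a n)).A m0) := by
        intro hε
        obtain ⟨e1, e2, e3⟩ := entry_true h0 hε
        exact ⟨e2.trans hd0', e1.trans hd0, e3⟩
      have F1 : ε m0 = false → EntryG (q + 1) ((strRep ε (sdim a n) (spos false a n)).A m0) := by
        intro hε
        obtain ⟨e1, e2, e3⟩ := entry_false h0 hε
        exact ⟨e2.trans hd0, e1.trans hd0', e3⟩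
      have G0 : ε m1 = true → EntryF (q + 1) ((strRep ε (sdim a n) (spos false a n)).A m1) := by
        intro hε
        obtain ⟨e1, e2, e3⟩ := entry_true h1 hε
        exact ⟨e2.trans hd1', e1.trans hd1, e3⟩
      have G1 : ε m1 = false → EntryFT (q + 1) ((strRep ε (sdim a n) (spos false a n)).A m1) := by
        intro hε
        obtain ⟨e1, e2, e3⟩ := entry_false h1 hε
        exact ⟨e2.trans hd1, e1.trans hd1', e3⟩
      cases e0 : ε m0 <;> cases e1 : ε m1
      · exact Or.inr ⟨rfl, Or.inr ⟨G1 e1, F1 e0⟩⟩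
      · exact Or.inl ⟨by simp, Or.inl ⟨G0 e1, F1 e0⟩⟩
      · exact Or.inl ⟨by simp, Or.inr ⟨G1 e1, F0 e0⟩⟩
      · exact Or.inr ⟨rfl, Or.inl ⟨G0 e1, F0 e0⟩⟩

lemma split_singular (X : Rep t ε) (i : Fin t) (h : ¬ Bij (X.A i)) :
    ∃ C Y : Rep t ε, Canonical C ∧ Nonempty (X ≅ dsum C Y) := by
  obtain ⟨a, n, y, g, ha, H⟩ := exists_sd X i h
  have hh : ∃ rev, Canonical (strRep ε (sdim a n) (spos rev a n)) ∧ 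
      ∃ v, ∃ s : Fin (sdim a n v), LocAt (strRep ε (sdim a n) (spos rev a n)) v s := by
    by_cases hr : (n + 1) % t = 0
    · exact str_canonII ha hr
    · obtain ⟨rev, hc⟩ := str_canonIII (ε := ε) ha hr
      refine ⟨rev, Or.inr (Or.inr hc), ?_⟩
      obtain ⟨v, s, hl⟩ := loc_of_canonical _ (Or.inr (Or.inr hc))
      exact ⟨v, s, hl⟩
  obtain ⟨rev, hc, v, s, hl⟩ := hh
  obtain ⟨psi, phi, hp⟩ := str_homs H (sposData (n := n) ha rev)
  obtain ⟨Y, hY⟩ := split hl psi phi (hp v s)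
  exact ⟨_, Y, hc, hY⟩

end Concrete

section RegularCase
open CategoryTheory

/-- Jordan block. -/
def jb (m : ℕ) (l : ℂ) : Matrix (Fin m) (Fin m) ℂ :=
  Matrix.of fun r s => if (s : ℕ) = r then l else if (s : ℕ) = r + 1 then 1 else 0

lemma jb_eq (m : ℕ) (l : ℂ) (r s : Fin m) :
    jb m l r s = (if s = r then l else 0) + (if (s : ℕ) = r + 1 then 1 else 0) := by
  simp only [jb, Matrix.of_apply, Fin.ext_iff]
  split_ifs <;> first | omega | simp

lemma mul_jb {n m : ℕ} (l : ℂ) (c : ℕ → Fin n → ℂ) (k : Fin n) (s : Fin m) :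
    (Matrix.of (fun (k : Fin n) (s : Fin m) => c s k) * jb m l) k s =
      l * c s k + (if (s : ℕ) = 0 then 0 else c (s - 1) k) := by
  rw [Matrix.mul_apply]
  simp only [jb_eq, Matrix.of_apply, mul_add, Finset.sum_add_distrib]
  congr 1
  · simp [mul_comm]
  · split_ifs with h
    · apply Finset.sum_eq_zero
      intro r _
      rw [if_neg (by omega), mul_zero]
    · rw [Finset.sum_eq_single ⟨s - 1, by omega⟩]
      · rw [if_pos (by simp only; omega), mul_one]
      · intro b _ hb
        rw [if_neg, mul_zero]
        intro e; apply hb; apply Fin.ext; simp only; omega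
      · simp

lemma jb_mul {n m : ℕ} (l : ℂ) (c : ℕ → Fin n → ℂ) (k : Fin n) (r : Fin m) :
    (jb m l * Matrix.of (fun (r : Fin m) (k : Fin n) => c r k)) r k =
      l * c r k + (if (r : ℕ) + 1 = m then 0 else c (r + 1) k) := by
  rw [Matrix.mul_apply]
  simp only [jb_eq, Matrix.of_apply, add_mul, Finset.sum_add_distrib]
  congr 1
  · simp
  · split_ifs with h
    · apply Finset.sum_eq_zero
      intro r _
      rw [if_neg (by omega), zero_mul]
    · rw [Finset.sum_eq_single ⟨r + 1, by omega⟩]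
      · rw [if_pos rfl, one_mul]
      · intro b _ hb
        rw [if_neg, zero_mul]
        intro e; apply hb; apply Fin.ext; simp only; omega
      · simp

lemma jordan_data {n : ℕ} (N : Matrix (Fin n) (Fin n) ℂ) (x0 : Fin n → ℂ) (hx0 : x0 ≠ 0)
    (hN : N *ᵥ x0 = 0) : ∃ (m : ℕ) (x w : Fin n → ℂ), 1 ≤ m ∧ N ^ m *ᵥ x = 0 ∧
      w ᵥ* N ^ m = 0 ∧ w ⬝ᵥ (N ^ (m - 1) *ᵥ x) ≠ 0 := by
  classical
  have hex : ∃ k, ∀ z, N ^ (k + 1) *ᵥ z = 0 → N ^ k *ᵥ z = 0 := by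
    refine ⟨n, fun z hz => ?_⟩
    have h := Module.End.ker_pow_eq_ker_pow_finrank_of_le (f := Matrix.toLin' N) (m := n + 1)
      (by simp)
    have h1 : z ∈ LinearMap.ker (Matrix.toLin' N ^ (n + 1)) := by
      rw [LinearMap.mem_ker, ← Matrix.toLin'_pow, Matrix.toLin'_apply, hz]
    rw [h, LinearMap.mem_ker, ← Matrix.toLin'_pow, Matrix.toLin'_apply] at h1
    simpa using h1
  set m := Nat.find hex with hm
  have h1 := Nat.find_spec hex
  rw [← hm] at h1
  have hm0 : m ≠ 0 := by
    intro h0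
    rw [h0] at h1
    have := h1 x0 (by simpa using hN)
    simp at this
    exact hx0 this
  have h2 := Nat.find_min hex (m := m - 1) (by omega)
  push Not at h2
  obtain ⟨x, hx1, hx2⟩ := h2
  rw [show m - 1 + 1 = m by omega] at hx1
  have hnot : N ^ (m - 1) *ᵥ x ∉ LinearMap.range (Matrix.toLin' (N ^ m)) := by
    rintro ⟨z, hz⟩
    rw [Matrix.toLin'_apply] at hz
    apply hx2
    rw [← hz]
    apply h1
    rw [pow_succ', ← Matrix.mulVec_mulVec, hz, Matrix.mulVec_mulVec, ← pow_succ',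
      show m - 1 + 1 = m by omega, hx1]
  obtain ⟨f, hf1, hf2⟩ := Submodule.exists_le_ker_of_notMem hnot
  have hfw : ∀ v, (fun k => f (Pi.single k 1)) ⬝ᵥ v = f v := by
    intro v
    conv_rhs => rw [pi_eq_sum_univ' v]
    rw [map_sum]
    apply Finset.sum_congr rfl
    intro j _
    rw [map_smul, smul_eq_mul, mul_comm]
  refine ⟨m, x, fun k => f (Pi.single k 1), by omega, hx1, ?_, ?_⟩
  · ext k
    have := hf2 (LinearMap.mem_range_self (Matrix.toLin' (N ^ m)) (Pi.single k 1))
    rw [LinearMap.mem_ker, ← hfw, Matrix.toLin'_apply, Matrix.mulVec_single_one] at this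
    exact this
  · rw [hfw]; exact hf1

lemma jordan_split {n : ℕ} (hn : 0 < n) (B : Matrix (Fin n) (Fin n) ℂ) (hB : IsUnit B) :
    ∃ (m : ℕ) (l : ℂ) (Ψ : Matrix (Fin n) (Fin m) ℂ) (Φ : Matrix (Fin m) (Fin n) ℂ)
      (hm : 1 ≤ m), l ≠ 0 ∧ Ψ * jb m l = B * Ψ ∧ Φ * B = jb m l * Φ ∧
        (Φ * Ψ) ⟨0, hm⟩ ⟨0, hm⟩ ≠ 0 := by
  have : Nonempty (Fin n) := ⟨⟨0, hn⟩⟩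
  obtain ⟨l, hl⟩ := Module.End.exists_eigenvalue (Matrix.toLin' B)
  obtain ⟨x0, hx0⟩ := hl.exists_hasEigenvector
  have hx := hx0.apply_eq_smul
  rw [Matrix.toLin'_apply] at hx
  have hl0 : l ≠ 0 := by
    rintro rfl
    apply hx0.2
    have h1 : B⁻¹ *ᵥ (B *ᵥ x0) = x0 := by
      rw [Matrix.mulVec_mulVec, Matrix.nonsing_inv_mul _ ((Matrix.isUnit_iff_isUnit_det _).1 hB),
        Matrix.one_mulVec]
    rw [← h1, hx]; simp
  obtain ⟨m, x, w, hm, h1, h2, h3⟩ := jordan_data (B - l • (1 : Matrix (Fin n) (Fin n) ℂ)) x0 hx0.2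
    (by rw [Matrix.sub_mulVec, hx, Matrix.smul_mulVec, Matrix.one_mulVec, sub_self])
  set N := B - l • (1 : Matrix (Fin n) (Fin n) ℂ) with hN
  have hBN : B = l • (1 : Matrix (Fin n) (Fin n) ℂ) + N := by rw [hN]; abel
  refine ⟨m, l, Matrix.of fun k s => (N ^ (m - 1 - (s : ℕ)) *ᵥ x) k,
    Matrix.of fun r k => (w ᵥ* N ^ (r : ℕ)) k, hm, hl0, ?_, ?_, ?_⟩
  · ext k s
    rw [mul_jb l (fun s => N ^ (m - 1 - s) *ᵥ x)]
    have hR : (B * Matrix.of fun k (s : Fin m) => (N ^ (m - 1 - (s : ℕ)) *ᵥ x) k) k s =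
      (B *ᵥ (N ^ (m - 1 - (s : ℕ)) *ᵥ x)) k := rfl
    rw [hR]
    conv_rhs => rw [hBN]
    rw [Matrix.add_mulVec, Matrix.smul_mulVec, Matrix.one_mulVec, Pi.add_apply, Pi.smul_apply,
      smul_eq_mul, Matrix.mulVec_mulVec, ← pow_succ']
    congr 1
    split_ifs with h0
    · rw [h0, show m - 1 - 0 + 1 = m by omega, h1]; rfl
    · rw [show m - 1 - (s - 1) = m - 1 - (s : ℕ) + 1 by omega]
  · ext r k
    rw [jb_mul l (fun r => w ᵥ* N ^ r)]
    have hL : ((Matrix.of fun (r : Fin m) k => (w ᵥ* N ^ (r : ℕ)) k) * B) r k =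
      ((w ᵥ* N ^ (r : ℕ)) ᵥ* B) k := rfl
    rw [hL]
    conv_lhs => rw [hBN]
    rw [Matrix.vecMul_add, Matrix.vecMul_smul, Matrix.vecMul_one, Pi.add_apply, Pi.smul_apply,
      smul_eq_mul, Matrix.vecMul_vecMul, ← pow_succ]
    congr 1
    split_ifs with h0
    · rw [h0, h2]; rfl
    · rfl
  · have : ((Matrix.of fun (r : Fin m) k => (w ᵥ* N ^ (r : ℕ)) k) *
      (Matrix.of fun k (s : Fin m) => (N ^ (m - 1 - (s : ℕ)) *ᵥ x) k)) ⟨0, hm⟩ ⟨0, hm⟩ =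
      (w ᵥ* N ^ 0) ⬝ᵥ (N ^ (m - 1 - 0) *ᵥ x) := rfl
    rw [this]
    simpa using h3

lemma next_val (i : Fin t) : (next i : ℕ) = if (i : ℕ) + 1 = t then 0 else (i : ℕ) + 1 := by
  have := i.2
  simp only [next]
  split_ifs with h
  · rw [h, Nat.mod_self]
  · exact Nat.mod_eq_of_lt (by omega)

lemma transport {n : ℕ} (A : Fin t → Matrix (Fin n) (Fin n) ℂ) (hA : ∀ i, IsUnit (A i)) (k : ℕ) :
    ∃ S : Fin t → Matrix (Fin n) (Fin n) ℂ, (∀ v, IsUnit (S v)) ∧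
      ∀ i : Fin t, (i : ℕ) ≠ 0 → (i : ℕ) < k → S (tgt ε i) = A i * S (src ε i) := by
  induction k with
  | zero => exact ⟨fun _ => 1, fun _ => isUnit_one, fun i _ h => absurd h (by omega)⟩
  | succ k ih =>
    obtain ⟨S, hS, h⟩ := ih
    by_cases hk : k < t ∧ k ≠ 0
    · obtain ⟨m, hm⟩ : ∃ m : Fin t, (m : ℕ) = k := ⟨⟨k, hk.1⟩, rfl⟩
      have hnm : next m ≠ m := by
        intro e
        have := congrArg Fin.val e
        rw [next_val] at this
        split_ifs at this <;> omega
      refine ⟨Function.update S (next m) (if ε m then A m * S m else (A m)⁻¹ * S m), ?_, ?_⟩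
      · intro v
        by_cases hv : v = next m
        · subst hv
          rw [Function.update_self]
          split_ifs
          · exact (hA m).mul (hS m)
          · exact ((Matrix.isUnit_nonsing_inv_iff).2 (hA m)).mul (hS m)
        · rw [Function.update_of_ne hv]; exact hS v
      · intro i hi0 hik
        by_cases hi : i = m
        · subst hi
          cases hε : ε i
          · have h1 : src ε i = next i := by simp [src, hε]
            have h2 : tgt ε i = i := by simp [tgt, hε]
            rw [h1, h2, Function.update_self, Function.update_of_ne hnm.symm]
            simp only [Bool.false_eq_true, if_false]
            rw [← Matrix.mul_assoc,
              Matrix.mul_nonsing_inv _ ((Matrix.isUnit_iff_isUnit_det _).1 (hA i)), Matrix.one_mul]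
          · have h1 : src ε i = i := by simp [src, hε]
            have h2 : tgt ε i = next i := by simp [tgt, hε]
            rw [h1, h2, Function.update_self, Function.update_of_ne hnm.symm]
            simp only [if_true]
        · have him : (i : ℕ) ≠ m := fun e => hi (Fin.ext e)
          have e1 : i ≠ next m := by
            intro e
            have := congrArg Fin.val e
            rw [next_val] at this
            split_ifs at this <;> omega
          have e2 : next i ≠ next m := fun e => hi (next_inj e)
          have e3 : tgt ε i ≠ next m := by unfold tgt; split_ifs <;> assumption
          have e4 : src ε i ≠ next m := by unfold src; split_ifs <;> assumption
          rw [Function.update_of_ne e3, Function.update_of_ne e4]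
          exact h i hi0 (by omega)
    · exact ⟨S, hS, fun i h0 h1 => h i h0 (by have := i.2; omega)⟩

/-- Matrices of the canonical representation of type (i). -/
def cA (m : ℕ) (l : ℂ) (i : Fin t) : Matrix (Fin m) (Fin m) ℂ :=
  if (i : ℕ) = 0 then jb m l else 1

/-- The canonical representation of type (i). -/
def canI (ε : Fin t → Bool) (m : ℕ) (l : ℂ) : Rep t ε where
  d _ := m
  A i := cA m l i

lemma split_const {n : ℕ} (hn : 0 < n) (i0 : Fin t) (hi0 : (i0 : ℕ) = 0)
    (A : Fin t → Matrix (Fin n) (Fin n) ℂ) (hA : ∀ i, IsUnit (A i)) :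
    ∃ C Y : Rep t ε, Canonical C ∧ Nonempty ((⟨fun _ => n, A⟩ : Rep t ε) ≅ dsum C Y) := by
  obtain ⟨S, hS, h⟩ := transport (ε := ε) A hA t
  have hS1 : ∀ v, (S v)⁻¹ * S v = 1 := fun v =>
    Matrix.nonsing_inv_mul _ ((Matrix.isUnit_iff_isUnit_det _).1 (hS v))
  have hS2 : ∀ v, S v * (S v)⁻¹ = 1 := fun v =>
    Matrix.mul_nonsing_inv _ ((Matrix.isUnit_iff_isUnit_det _).1 (hS v))
  obtain ⟨m, l, Ψ, Φ, hm, hl, e1, e2, e3⟩ := jordan_split hn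
    ((S (tgt ε i0))⁻¹ * A i0 * S (src ε i0))
    ((((Matrix.isUnit_nonsing_inv_iff).2 (hS _)).mul (hA i0)).mul (hS _))
  have hd : ∀ v, (canI ε m l).d v = m := fun _ => rfl
  have hId : ∀ k, k ≠ i0 → EntryId ((canI ε m l).A k) := by
    intro k hk
    have : (k : ℕ) ≠ 0 := fun e => hk (Fin.ext (e.trans hi0.symm))
    have key : ∀ r s, cA m l k r s = if (r : ℕ) = (s : ℕ) then 1 else 0 := by
      intro r s
      rw [cA, if_neg this, Matrix.one_apply]
      simp only [Fin.ext_iff]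
    exact key
  have hJ : EntryJ m l ((canI ε m l).A i0) := by
    have : cA m l i0 = jb m l := if_pos hi0
    have key : ∀ r s, cA m l i0 r s = if (s : ℕ) = (r : ℕ) then l else
        if (s : ℕ) = (r : ℕ) + 1 then 1 else 0 := by
      intro r s; rw [this]; rfl
    exact ⟨rfl, rfl, key⟩
  have hloc : LocAt (canI ε m l) i0 (⟨0, hm⟩ : Fin m) := locJ hd hId hJ _ _ rfl
  have hpsi : ∀ i, (S (tgt ε i) * Ψ) * cA m l i = A i * (S (src ε i) * Ψ) := by
    intro i
    by_cases hi : i = i0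
    · subst hi
      have : cA m l i = jb m l := if_pos hi0
      rw [this, Matrix.mul_assoc, e1]
      simp only [← Matrix.mul_assoc]
      rw [hS2, Matrix.one_mul]
    · have h0 : (i : ℕ) ≠ 0 := fun e => hi (Fin.ext (e.trans hi0.symm))
      have : cA m l i = 1 := if_neg h0
      rw [this, Matrix.mul_one, h i h0 i.2, Matrix.mul_assoc]
  have hphi : ∀ i, Φ * (S (tgt ε i))⁻¹ * A i = cA m l i * (Φ * (S (src ε i))⁻¹) := by
    intro i
    by_cases hi : i = i0
    · subst hi
      have : cA m l i = jb m l := if_pos hi0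
      rw [this, ← Matrix.mul_assoc (jb m l), ← e2]
      simp only [Matrix.mul_assoc]
      rw [hS2, Matrix.mul_one]
    · have h0 : (i : ℕ) ≠ 0 := fun e => hi (Fin.ext (e.trans hi0.symm))
      have : cA m l i = 1 := if_neg h0
      rw [this, Matrix.one_mul]
      have h5 : (S (tgt ε i))⁻¹ * A i = (S (src ε i))⁻¹ := by
        calc (S (tgt ε i))⁻¹ * A i = (S (tgt ε i))⁻¹ * (A i * S (src ε i)) * (S (src ε i))⁻¹ := by
              simp only [Matrix.mul_assoc]; rw [hS2, Matrix.mul_one]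
          _ = _ := by rw [← h i h0 i.2, hS1, Matrix.one_mul]
      rw [Matrix.mul_assoc, h5]
  let psi : canI ε m l ⟶ (⟨fun _ => n, A⟩ : Rep t ε) := mkHom (fun v => S v * Ψ) hpsi
  let phi : (⟨fun _ => n, A⟩ : Rep t ε) ⟶ canI ε m l := mkHom (fun v => Φ * (S v)⁻¹) hphi
  have hne : cm (psi ≫ phi) i0 (⟨0, hm⟩ : Fin m) (⟨0, hm⟩ : Fin m) ≠ 0 := by
    have : (Φ * (S i0)⁻¹) * (S i0 * Ψ) = Φ * Ψ := by
      rw [Matrix.mul_assoc, ← Matrix.mul_assoc _ (S i0), hS1, Matrix.one_mul]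
    rw [← this] at e3
    exact e3
  obtain ⟨Y, hY⟩ := split hloc psi phi hne
  exact ⟨canI ε m l, Y, Or.inl ⟨i0, m, l, hi0, hm, hl, hd, hId, hJ⟩, hY⟩

lemma split_regular (X : Rep t ε) (h : ∀ i, Bij (X.A i)) (hX : Nonzero X) :
    ∃ C Y : Rep t ε, Canonical C ∧ Nonempty (X ≅ dsum C Y) := by
  obtain ⟨v0, hv0⟩ := hX
  have ht : 0 < t := v0.pos
  obtain ⟨i0, hi0⟩ : ∃ i0 : Fin t, (i0 : ℕ) = 0 := ⟨⟨0, ht⟩, rfl⟩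
  have hd : ∀ v, X.d v = X.d v0 := by
    exact const_one X.d v0 (ε := ε) (fun k _ => (h k).dim)
  obtain ⟨d, A⟩ := X
  obtain ⟨n, hn⟩ : ∃ n, n = d v0 := ⟨_, rfl⟩
  obtain rfl : d = fun _ => n := funext fun v => (hd v).trans hn.symm
  apply split_const (Nat.pos_of_ne_zero hv0) i0 hi0
  intro i
  obtain ⟨B, h1, h2⟩ := h i
  exact ⟨⟨A i, B, h1, h2⟩, rfl⟩

end RegularCase

section Main
open CategoryTheory CategoryTheory.Limits

lemma split_any (X : Rep t ε) (hX : Nonzero X) :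
    ∃ C Y : Rep t ε, Canonical C ∧ Nonempty (X ≅ dsum C Y) := by
  by_cases h : ∀ i, Bij (X.A i)
  · exact split_regular X h hX
  · push Not at h
    obtain ⟨i, hi⟩ := h
    exact split_singular X i hi

lemma exists_decomp (N : ℕ) : ∀ X : Rep t ε, ∑ v, X.d v ≤ N →
    ∃ L : List (Rep t ε), (∀ Y ∈ L, Canonical Y) ∧ Nonempty (X ≅ dsumList L) := by
  induction N with
  | zero =>
    intro X h
    refine ⟨[], by simp, ?_⟩
    have hz : ∀ v, X.d v = 0 := by
      intro v
      have := Finset.single_le_sum (f := X.d) (fun _ _ => Nat.zero_le _) (Finset.mem_univ v)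
      omega
    have : X = zero t ε := by
      obtain ⟨d, A⟩ := X
      obtain rfl : d = fun _ => 0 := funext hz
      congr 1
      funext i
      ext r
      exact r.elim0
    rw [this]
    exact ⟨CategoryTheory.Iso.refl _⟩
  | succ N ih =>
    intro X h
    by_cases hX : Nonzero X
    · obtain ⟨C, Y, hC, ⟨e⟩⟩ := split_any X hX
      have hdim : ∀ v, X.d v = C.d v + Y.d v := fun v => dim_of_iso ⟨e⟩ v
      obtain ⟨v, s, -⟩ := loc_of_canonical C hC
      have hC1 : 1 ≤ ∑ v, C.d v := by
        have h1 := Finset.single_le_sum (f := C.d) (fun _ _ => Nat.zero_le _) (Finset.mem_univ v)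
        have := s.pos
        omega
      have hs : ∑ v, X.d v = ∑ v, C.d v + ∑ v, Y.d v := by
        rw [← Finset.sum_add_distrib]
        exact Finset.sum_congr rfl fun v _ => hdim v
      obtain ⟨L, hL, ⟨f⟩⟩ := ih Y (by omega)
      refine ⟨C :: L, ?_, ?_⟩
      · intro Z hZ
        rcases List.mem_cons.1 hZ with rfl | hZ
        · exact hC
        · exact hL Z hZ
      · exact ⟨e ≪≫ dsumIso C Y ≪≫ biprod.mapIso (CategoryTheory.Iso.refl C) f ≪≫
          (dsumIso C (dsumList L)).symm⟩
    · apply ih X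
      unfold Nonzero at hX
      push Not at hX
      rw [Finset.sum_eq_zero fun v _ => hX v]
      omega

lemma main_aux (X : Rep t ε) :
    ∃ L : List (Rep t ε),
      (∀ Y ∈ L, Canonical Y) ∧ Iso X (dsumList L) ∧
      ∀ L' : List (Rep t ε), (∀ Y ∈ L', Canonical Y) → Iso X (dsumList L') →
        (L : Multiset (Rep t ε)) = (L' : Multiset (Rep t ε)) := by
  obtain ⟨L, hL, ⟨e⟩⟩ := exists_decomp _ X le_rfl
  refine ⟨L, hL, iso_iff.2 ⟨e⟩, fun L' hL' h => ?_⟩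
  obtain ⟨e'⟩ := iso_iff.1 h
  rw [Multiset.coe_eq_coe]
  exact perm_of_iso Canonical loc_of_canonical (fun X Y hX hY => eq_of_iso hX hY) L L' hL hL'
    ⟨e.symm ≪≫ e'⟩

end Main

/-- Nazarova / Donovan–Freislich: every matrix representation of the cycle quiver
(`t ≥ 2`, arbitrary orientation) is isomorphic to a direct sum of canonical
representations of the forms (i), (ii), (iii), and the multiset of canonical summands
is uniquely determined (uniqueness up to permutation of summands). -/
theorem cycle_canonical_form (t : ℕ) (ht : 2 ≤ t) (ε : Fin t → Bool) (X : Rep t ε) :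
    ∃ L : List (Rep t ε),
      (∀ Y ∈ L, Canonical Y) ∧ Iso X (dsumList L) ∧
      ∀ L' : List (Rep t ε), (∀ Y ∈ L', Canonical Y) → Iso X (dsumList L') →
        (L : Multiset (Rep t ε)) = (L' : Multiset (Rep t ε)) := by
  exact main_aux X

end CycleQuiver
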